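/- arXiv:1006.4769 — 2 statements merged into one kernel-verified Lean document; each statement's English description precedes it below -/
import Mathlib

section
/- Let α ∈ (0,1) and let (f_k)_{k≥0} be nonnegative reals with ∑ f_k = 1, m₁ := ∑ k f_k ∈ (0,∞), m₂ := ∑ k(k−1) f_k ∈ (0,∞); set f(s) := ∑ f_k s^k for s ∈ [0,1], Φ(x) := m₁x − (1 − f(1−x)), Ψ(x) := Φ(x)/x for x ∈ (0,1] and Ψ(0) := 0. Let mₒ : (0,∞) → [0,∞) be measurable, set k₄(u) := α m₁ e^{−u} + mₒ(u), and assume ∫₀^∞ k₄(u) du = 1 and lim_{u→∞} u² k₄(u) = c₄ for some c₄ > 0. Suppose q : [0,∞) → [0,1] is measurable, satisfies q(t) = e^{−t} + ∫₀^t q(t−u)·(k₄(u) − α Ψ(q(t−u)) e^{−u}) du for all t ≥ 0, and additionally liminf_{t→∞} t·q(t)/log t ≥ c₄/(α m₂) and limsup_{t→∞} t·q(t)/log t < ∞. Then lim_{t→∞} t·q(t)/log t = C, where C := 3c₄/(α m₂); i.e., q(t) = C·(log t)/t·(1+o(1)) as t → ∞. -/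
open MeasureTheory Filter
open scoped Topology

/-- A bounded solution of a convolution inequality with sub-stochastic kernel supported on `(0, η]`
stays nonpositive once it is nonpositive on an initial window of length `η`. -/
lemma nonpos_of_le_integral_kernel {k D : ℝ → ℝ} {a b η M : ℝ} (hη : 0 ≤ η)
    (hk : IntervalIntegrable k volume 0 η) (hk0 : ∀ u, 0 < u → 0 ≤ k u)
    (hr : ∫ u in (0:ℝ)..η, k u < 1)
    (hD : ∀ t ∈ Set.Icc a b, D t ≤ ∫ u in (0:ℝ)..η, k u * max (D (t - u)) 0)
    (h0 : ∀ s ∈ Set.Icc (a - η) a, D s ≤ 0) (hM : ∀ s ∈ Set.Icc a b, D s ≤ M) :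
    ∀ t ∈ Set.Icc a b, D t ≤ 0 := by
  set r := ∫ u in (0:ℝ)..η, k u with hrdef
  have hr0 : 0 ≤ r := by
    rw [hrdef, intervalIntegral.integral_of_le hη]
    exact setIntegral_nonneg measurableSet_Ioc fun u hu => hk0 u hu.1
  have key : ∀ n : ℕ, ∀ t ∈ Set.Icc a b, D t ≤ r ^ n * max M 0 := by
    intro n
    induction n with
    | zero => intro t ht; simpa using Or.inl (hM t ht)
    | succ n ih =>
      intro t ht
      have hpow : 0 ≤ r ^ n * max M 0 := by positivity
      calc D t ≤ ∫ u in (0:ℝ)..η, k u * max (D (t - u)) 0 := hD t ht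
        _ ≤ ∫ u in (0:ℝ)..η, k u * (r ^ n * max M 0) := by
          rw [intervalIntegral.integral_of_le hη, intervalIntegral.integral_of_le hη]
          apply integral_mono_of_nonneg
          · filter_upwards [ae_restrict_mem measurableSet_Ioc] with u hu
            exact mul_nonneg (hk0 u hu.1) (le_max_right _ _)
          · exact ((intervalIntegrable_iff_integrableOn_Ioc_of_le hη).1 hk).mul_const _
          · filter_upwards [ae_restrict_mem measurableSet_Ioc] with u hu
            refine mul_le_mul_of_nonneg_left (max_le ?_ hpow) (hk0 u hu.1)
            rcases le_total (t - u) a with h | h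
            · exact (h0 _ ⟨by linarith [hu.2, ht.1], h⟩).trans hpow
            · exact ih _ ⟨h, by linarith [hu.1, ht.2]⟩
        _ = r ^ (n + 1) * max M 0 := by
          rw [intervalIntegral.integral_mul_const, ← hrdef]; ring
  intro t ht
  have hlim : Tendsto (fun n : ℕ => r ^ n * max M 0) atTop (𝓝 (0 * max M 0)) :=
    (tendsto_pow_atTop_nhds_zero_of_lt_one hr0 hr).mul_const _
  rw [zero_mul] at hlim
  exact ge_of_tendsto' hlim fun n => key n t ht

lemma tendsto_log_mul_div_log {h : ℝ} (hh : 0 < h) :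
    Tendsto (fun T : ℝ => Real.log (h * T) / Real.log T) atTop (𝓝 1) := by
  have h1 : Tendsto (fun T : ℝ => Real.log h / Real.log T + 1) atTop (𝓝 (0 + 1)) :=
    (Real.tendsto_log_atTop.const_div_atTop _).add_const 1
  rw [zero_add] at h1
  refine h1.congr' ?_
  filter_upwards [eventually_gt_atTop 1] with T hT
  have : 0 < Real.log T := Real.log_pos hT
  rw [Real.log_mul hh.ne' (by linarith)]
  field_simp

/-- Integrating the bound `g u ≤ b (n + 1) (log u)ⁿ / u`. -/
lemma eventually_integral_le_log_pow {g : ℝ → ℝ} {b b' h : ℝ} (n : ℕ)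
    (hg : ∀ y, 0 ≤ y → IntervalIntegrable g volume 0 y)
    (hle : ∀ᶠ u in atTop, g u ≤ b * ((n + 1) * Real.log u ^ n / u)) (hh : 0 < h) (hb : b < b') :
    ∀ᶠ T in atTop, ∫ u in (0:ℝ)..h * T, g u ≤ b' * Real.log T ^ (n + 1) := by
  obtain ⟨U₀, hU₀⟩ := eventually_atTop.1 hle
  set U := max U₀ 1
  have hU1 : 1 ≤ U := le_max_right _ _
  set K := (∫ u in (0:ℝ)..U, g u) - b * Real.log U ^ (n + 1)
  have hK : ∀ y, U ≤ y → ∫ u in (0:ℝ)..y, g u ≤ K + b * Real.log y ^ (n + 1) := by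
    intro y hy
    have hsub : IntervalIntegrable g volume U y :=
      (hg U (by linarith)).symm.trans (hg y (by linarith))
    have hcont : IntervalIntegrable (fun u : ℝ => b * ((n + 1) * Real.log u ^ n / u)) volume U y := by
      apply ContinuousOn.intervalIntegrable
      rw [Set.uIcc_of_le hy]
      intro u hu
      have : u ≠ 0 := by linarith [hu.1]
      apply ContinuousAt.continuousWithinAt
      fun_prop (disch := assumption)
    have hFTC : ∫ u in U..y, b * ((n + 1) * Real.log u ^ n / u)
        = b * Real.log y ^ (n + 1) - b * Real.log U ^ (n + 1) := by
      apply intervalIntegral.integral_eq_sub_of_hasDerivAt _ hcont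
      intro u hu
      rw [Set.uIcc_of_le hy] at hu
      have hu0 : u ≠ 0 := by linarith [hu.1]
      refine (((Real.hasDerivAt_log hu0).pow (n + 1)).const_mul b).congr_deriv ?_
      rw [Nat.add_sub_cancel]
      push_cast
      field_simp
    have hmono : ∫ u in U..y, g u ≤ ∫ u in U..y, b * ((n + 1) * Real.log u ^ n / u) :=
      intervalIntegral.integral_mono_on hy hsub hcont fun u hu =>
        hU₀ u ((le_max_left _ _).trans hu.1)
    have hadd := intervalIntegral.integral_add_adjacent_intervals (hg U (by linarith)) hsub
    simp only [K]
    linarith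
  have hlim : Tendsto (fun T : ℝ => K / Real.log T ^ (n + 1)
      + b * (Real.log (h * T) / Real.log T) ^ (n + 1)) atTop (𝓝 (0 + b * 1 ^ (n + 1))) := by
    refine Tendsto.add ?_ (((tendsto_log_mul_div_log hh).pow _).const_mul b)
    exact Tendsto.const_div_atTop
      ((tendsto_pow_atTop (Nat.succ_ne_zero n)).comp Real.tendsto_log_atTop) K
  have hlt : 0 + b * (1:ℝ) ^ (n + 1) < b' := by simpa using hb
  filter_upwards [hlim.eventually_lt_const hlt, eventually_gt_atTop 1,
    eventually_ge_atTop (U / h)] with T hT hT1 hTU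
  have hpos : 0 < Real.log T ^ (n + 1) := pow_pos (Real.log_pos hT1) _
  have hy := hK (h * T) (by rwa [div_le_iff₀' hh] at hTU)
  rw [div_pow] at hT
  have : K / Real.log T ^ (n + 1) + b * (Real.log (h * T) ^ (n + 1) / Real.log T ^ (n + 1))
    = (K + b * Real.log (h * T) ^ (n + 1)) / Real.log T ^ (n + 1) := by ring
  rw [this, div_lt_iff₀ hpos] at hT
  linarith

lemma eventually_log_pow_le_integral {g : ℝ → ℝ} {b b' h : ℝ} (n : ℕ)
    (hg : ∀ y, 0 ≤ y → IntervalIntegrable g volume 0 y)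
    (hle : ∀ᶠ u in atTop, b * ((n + 1) * Real.log u ^ n / u) ≤ g u) (hh : 0 < h) (hb : b' < b) :
    ∀ᶠ T in atTop, b' * Real.log T ^ (n + 1) ≤ ∫ u in (0:ℝ)..h * T, g u := by
  have := eventually_integral_le_log_pow (g := fun u => - g u) (b := -b) (b' := -b') n
    (fun y hy => (hg y hy).neg) (by filter_upwards [hle] with u hu; linarith) hh (by linarith)
  filter_upwards [this] with T hT
  rw [intervalIntegral.integral_neg] at hT
  linarith

/-- The one-step contribution `k(u) x - α e⁻ᵘ Φ(x)` of the evolution equation. -/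
noncomputable def netKernel (α : ℝ) (k Φ : ℝ → ℝ) (u x : ℝ) : ℝ :=
  k u * x - α * Real.exp (-u) * Φ x

/-- `q` solves the evolution equation with kernel `k`, whose tail is `c / u²`, and with
nonlinearity `Φ`, which is quadratic at the origin with coefficient `κ`. -/
structure IsEvolution (α m c κ : ℝ) (k Φ q : ℝ → ℝ) : Prop where
  α_pos : 0 < α
  m_pos : 0 < m
  c_pos : 0 < c
  κ_pos : 0 < κ
  k_meas : Measurable k
  k_int : IntegrableOn k (Set.Ioi 0)
  k_one : ∫ u in Set.Ioi (0:ℝ), k u = 1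
  exp_le : ∀ u, 0 < u → α * m * Real.exp (-u) ≤ k u
  tail : Tendsto (fun u : ℝ => u ^ 2 * k u) atTop (𝓝 c)
  Φ_mono : Monotone Φ
  Φ_lip : ∀ x y, y ≤ x → Φ x - Φ y ≤ m * (x - y)
  Φ_zero : Φ 0 = 0
  Φ_quad : Tendsto (fun x : ℝ => Φ x / x ^ 2) (𝓝[>] 0) (𝓝 κ)
  q_meas : Measurable q
  q_nonneg : ∀ t, 0 ≤ q t
  q_le_one : ∀ t, q t ≤ 1
  eqn : ∀ t, 0 ≤ t → q t = Real.exp (-t) + ∫ u in (0:ℝ)..t, netKernel α k Φ u (q (t - u))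

namespace IsEvolution

variable {α m c κ : ℝ} {k Φ q : ℝ → ℝ}

lemma k_nonneg (H : IsEvolution α m c κ k Φ q) {u : ℝ} (hu : 0 < u) : 0 ≤ k u := by
  have := H.exp_le u hu
  have := H.α_pos
  have := H.m_pos
  have : 0 < α * m * Real.exp (-u) := by positivity
  linarith

lemma k_intervalIntegrable (H : IsEvolution α m c κ k Φ q) {a b : ℝ} (ha : 0 ≤ a) (hb : 0 ≤ b) :
    IntervalIntegrable k volume a b := by
  rw [intervalIntegrable_iff]
  exact H.k_int.mono_set fun u hu => lt_of_le_of_lt (le_min ha hb) hu.1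

lemma q_intervalIntegrable (H : IsEvolution α m c κ k Φ q) (a b : ℝ) :
    IntervalIntegrable q volume a b := by
  rw [intervalIntegrable_iff]
  refine Integrable.mono' (g := fun _ => (1:ℝ)) (integrableOn_const (by simp))
    H.q_meas.aestronglyMeasurable (ae_of_all _ fun t => ?_)
  rw [Real.norm_of_nonneg (H.q_nonneg t)]
  exact H.q_le_one t

lemma moment_intervalIntegrable (H : IsEvolution α m c κ k Φ q) {y : ℝ} (hy : 0 ≤ y) :
    IntervalIntegrable (fun u => u * k u) volume 0 y :=
  (H.k_intervalIntegrable le_rfl hy).continuousOn_mul continuousOn_id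

lemma Φ_nonneg (H : IsEvolution α m c κ k Φ q) {x : ℝ} (hx : 0 ≤ x) : 0 ≤ Φ x := by
  rw [← H.Φ_zero]; exact H.Φ_mono hx

lemma Φ_le (H : IsEvolution α m c κ k Φ q) {x : ℝ} (hx : 0 ≤ x) : Φ x ≤ m * x := by
  have := H.Φ_lip x 0 hx
  rw [H.Φ_zero] at this
  linarith

lemma abs_Φ_le (H : IsEvolution α m c κ k Φ q) (x : ℝ) : |Φ x| ≤ m * |x| := by
  rcases le_total 0 x with hx | hx
  · rw [abs_of_nonneg hx, abs_of_nonneg (H.Φ_nonneg hx)]; exact H.Φ_le hx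
  · have h1 := H.Φ_lip 0 x hx
    have h2 := H.Φ_mono hx
    rw [H.Φ_zero] at h1 h2
    rw [abs_of_nonpos hx, abs_of_nonpos h2]; linarith

lemma netKernel_sub_le (H : IsEvolution α m c κ k Φ q) {u : ℝ} (hu : 0 < u) (x y : ℝ) :
    netKernel α k Φ u x - netKernel α k Φ u y ≤ k u * max (x - y) 0 := by
  have hα := H.α_pos
  have he : 0 < α * Real.exp (-u) := by positivity
  unfold netKernel
  rcases le_total y x with h | h
  · rw [max_eq_left (by linarith)]
    nlinarith [H.Φ_mono h]
  · rw [max_eq_right (by linarith), mul_zero]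
    have h1 := mul_le_mul_of_nonneg_left (H.Φ_lip y x h) he.le
    have h2 := mul_le_mul_of_nonneg_right (H.exp_le u hu) (sub_nonneg.2 h)
    linarith

lemma netKernel_nonneg (H : IsEvolution α m c κ k Φ q) {u x : ℝ} (hu : 0 < u) (hx : 0 ≤ x) :
    0 ≤ netKernel α k Φ u x := by
  have h := H.netKernel_sub_le hu 0 x
  rw [max_eq_right (by linarith)] at h
  simp only [netKernel, H.Φ_zero] at h ⊢
  linarith

lemma netKernel_le (H : IsEvolution α m c κ k Φ q) {u x : ℝ} (hx : 0 ≤ x) :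
    netKernel α k Φ u x ≤ k u * x := by
  have hα := H.α_pos
  have := H.Φ_nonneg hx
  have : 0 ≤ α * Real.exp (-u) * Φ x := by positivity
  unfold netKernel
  linarith

lemma le_netKernel (H : IsEvolution α m c κ k Φ q) {u x : ℝ} (hx : 0 ≤ x) :
    (k u - α * m * Real.exp (-u)) * x ≤ netKernel α k Φ u x := by
  have hα := H.α_pos
  have h1 : 0 < α * Real.exp (-u) := by positivity
  have := mul_le_mul_of_nonneg_left (H.Φ_le hx) h1.le
  unfold netKernel
  linarith

lemma netKernel_intervalIntegrable (H : IsEvolution α m c κ k Φ q) {w : ℝ → ℝ}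
    (hw : Measurable w) {a b B : ℝ} (ha : 0 ≤ a) (hab : a ≤ b)
    (hB : ∀ u ∈ Set.Ioc a b, |w u| ≤ B) :
    IntervalIntegrable (fun u => netKernel α k Φ u (w u)) volume a b := by
  rw [intervalIntegrable_iff_integrableOn_Ioc_of_le hab]
  have hk : IntegrableOn k (Set.Ioc a b) := H.k_int.mono_set fun u hu => lt_of_le_of_lt ha hu.1
  have hα := H.α_pos
  have hm := H.m_pos
  refine Integrable.mono' (g := fun u => k u * (2 * B)) (hk.mul_const _) ?_ ?_
  · unfold netKernel
    have h1 := H.k_meas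
    have h2 : Measurable fun u => Φ (w u) := H.Φ_mono.measurable.comp hw
    have h3 : Measurable fun u : ℝ => Real.exp (-u) := by fun_prop
    exact ((h1.mul hw).sub ((h3.const_mul α).mul h2)).aestronglyMeasurable
  · filter_upwards [ae_restrict_mem measurableSet_Ioc] with u hu
    have hu0 : 0 < u := lt_of_le_of_lt ha hu.1
    have hk0 := H.k_nonneg hu0
    have h1 : |k u * w u| ≤ k u * B := by
      rw [abs_mul, abs_of_nonneg hk0]; exact mul_le_mul_of_nonneg_left (hB u hu) hk0
    have h2 : |α * Real.exp (-u) * Φ (w u)| ≤ k u * B := by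
      have he : 0 < α * Real.exp (-u) := by positivity
      rw [abs_mul, abs_of_pos he]
      calc α * Real.exp (-u) * |Φ (w u)| ≤ α * Real.exp (-u) * (m * |w u|) :=
            mul_le_mul_of_nonneg_left (H.abs_Φ_le _) he.le
        _ = α * m * Real.exp (-u) * |w u| := by ring
        _ ≤ k u * |w u| := mul_le_mul_of_nonneg_right (H.exp_le u hu0) (abs_nonneg _)
        _ ≤ k u * B := mul_le_mul_of_nonneg_left (hB u hu) hk0
    rw [Real.norm_eq_abs, netKernel]
    calc _ ≤ |k u * w u| + |α * Real.exp (-u) * Φ (w u)| := abs_sub _ _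
      _ ≤ k u * (2 * B) := by linarith

lemma abs_q_le (H : IsEvolution α m c κ k Φ q) (t : ℝ) : |q t| ≤ 1 := by
  rw [abs_of_nonneg (H.q_nonneg t)]; exact H.q_le_one t

/-- The evolution equation with the memory split at lag `η`. -/
lemma eqn_split (H : IsEvolution α m c κ k Φ q) {t η : ℝ} (hη : 0 ≤ η) (ht : η ≤ t) :
    q t = Real.exp (-t) + (∫ u in (0:ℝ)..η, netKernel α k Φ u (q (t - u)))
      + ∫ s in (0:ℝ)..t - η, netKernel α k Φ (t - s) (q s) := by
  have hmeas : Measurable fun u => q (t - u) := H.q_meas.comp (by fun_prop)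
  have h1 := H.netKernel_intervalIntegrable hmeas le_rfl hη (B := 1) fun u _ => H.abs_q_le _
  have h2 := H.netKernel_intervalIntegrable hmeas hη ht (B := 1) fun u _ => H.abs_q_le _
  have h3 := intervalIntegral.integral_comp_sub_left
    (fun u => netKernel α k Φ u (q (t - u))) (a := 0) (b := t - η) t
  simp only [sub_sub_cancel, sub_zero] at h3
  rw [H.eqn t (hη.trans ht), ← intervalIntegral.integral_add_adjacent_intervals h1 h2, h3]
  ring

lemma far_intervalIntegrable (H : IsEvolution α m c κ k Φ q) {t a b : ℝ} (hab : a ≤ b)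
    (hb : b ≤ t) :
    IntervalIntegrable (fun s => netKernel α k Φ (t - s) (q s)) volume a b := by
  have hmeas : Measurable fun u => q (t - u) := H.q_meas.comp (by fun_prop)
  have h := H.netKernel_intervalIntegrable hmeas (a := t - b) (b := t - a) (B := 1)
    (by linarith) (by linarith) fun u _ => H.abs_q_le _
  have := h.comp_sub_left t
  simpa using this.symm

lemma integral_k_add_tail (H : IsEvolution α m c κ k Φ q) {η : ℝ} (hη : 0 ≤ η) :
    (∫ u in (0:ℝ)..η, k u) + ∫ u in Set.Ioi η, k u = 1 := by
  rw [← H.k_one, intervalIntegral.integral_of_le hη, ← Set.Ioc_union_Ioi_eq_Ioi hη,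
    setIntegral_union (Set.Ioc_disjoint_Ioi le_rfl) measurableSet_Ioi
      (H.k_int.mono_set Set.Ioc_subset_Ioi_self) (H.k_int.mono_set (Set.Ioi_subset_Ioi hη))]

lemma eventually_k_le (H : IsEvolution α m c κ k Φ q) {c' : ℝ} (hc : c < c') :
    ∀ᶠ u in atTop, k u ≤ c' / u ^ 2 := by
  filter_upwards [H.tail.eventually_lt_const hc, eventually_gt_atTop 0] with u hu hu0
  rw [le_div_iff₀' (by positivity)]
  exact hu.le

lemma eventually_le_k (H : IsEvolution α m c κ k Φ q) {c' : ℝ} (hc : c' < c) :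
    ∀ᶠ u in atTop, c' / u ^ 2 ≤ k u := by
  filter_upwards [H.tail.eventually_const_lt hc, eventually_gt_atTop 0] with u hu hu0
  rw [div_le_iff₀' (by positivity)]
  exact hu.le

lemma eventually_le_k_sub_exp (H : IsEvolution α m c κ k Φ q) {c' : ℝ} (hc : c' < c) :
    ∀ᶠ u in atTop, c' / u ^ 2 ≤ k u - α * m * Real.exp (-u) := by
  have h := H.tail.sub ((Real.tendsto_pow_mul_exp_neg_atTop_nhds_zero 2).const_mul (α * m))
  rw [mul_zero, sub_zero] at h
  filter_upwards [h.eventually_const_lt hc, eventually_gt_atTop 0] with u hu hu0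
  rw [div_le_iff₀' (by positivity)]
  linarith

lemma integral_k_lt_one (H : IsEvolution α m c κ k Φ q) {η : ℝ} (hη : 0 ≤ η) :
    ∫ u in (0:ℝ)..η, k u < 1 := by
  have hc := H.c_pos
  obtain ⟨V, hV⟩ := ((H.eventually_le_k (half_lt_self hc)).and (eventually_gt_atTop η)).exists_forall_of_atTop
  have hVη := (hV V le_rfl).2
  rw [← H.integral_k_add_tail hη]
  have hpos : 0 < ∫ u in Set.Ioi η, k u := by
    have h1 : ∫ u in V..V + 1, c / 2 / (V + 1) ^ 2 ≤ ∫ u in V..V + 1, k u := by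
      apply intervalIntegral.integral_mono_on (by linarith) (by simp)
        (H.k_intervalIntegrable (by linarith) (by linarith))
      intro u hu
      refine le_trans ?_ (hV u hu.1).1
      have : 0 < u := by linarith [hu.1]
      have := hu.2
      gcongr
    have h2 : ∫ u in V..V + 1, k u ≤ ∫ u in Set.Ioi η, k u := by
      rw [intervalIntegral.integral_of_le (by linarith)]
      apply setIntegral_mono_set (H.k_int.mono_set (Set.Ioi_subset_Ioi hη))
      · filter_upwards [ae_restrict_mem measurableSet_Ioi] with u hu
        exact H.k_nonneg (lt_of_le_of_lt hη hu)
      · exact LE.le.eventuallyLE fun u hu => hVη.trans hu.1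
    rw [intervalIntegral.integral_const] at h1
    have : 0 < (V + 1 - V) • (c / 2 / (V + 1) ^ 2) := by
      rw [add_sub_cancel_left, one_smul]
      have : 0 < V + 1 := by linarith
      positivity
    linarith
  linarith

lemma eventually_one_sub_le (H : IsEvolution α m c κ k Φ q) {c' : ℝ} (hc : c < c') :
    ∀ᶠ y in atTop, 1 - c' / y ≤ ∫ u in (0:ℝ)..y, k u := by
  obtain ⟨V, hV⟩ := (H.eventually_k_le hc).exists_forall_of_atTop
  filter_upwards [eventually_ge_atTop V, eventually_gt_atTop 0] with y hyV hy0
  rw [← H.integral_k_add_tail hy0.le]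
  have h1 : ∫ u in Set.Ioi y, k u ≤ ∫ u in Set.Ioi y, c' * u ^ (-2:ℝ) := by
    apply setIntegral_mono_on (H.k_int.mono_set (Set.Ioi_subset_Ioi hy0.le))
      ((integrableOn_Ioi_rpow_of_lt (by norm_num) hy0).const_mul _) measurableSet_Ioi
    intro u hu
    have hu0 : 0 < u := lt_trans hy0 hu
    have := hV u (hyV.trans (le_of_lt hu))
    rwa [Real.rpow_neg hu0.le, Real.rpow_ofNat, ← div_eq_mul_inv]
  rw [integral_const_mul, integral_Ioi_rpow_of_lt (by norm_num) hy0] at h1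
  have h2 : c' * (-y ^ ((-2:ℝ) + 1) / (-2 + 1)) = c' / y := by
    have : (-2:ℝ) + 1 = -1 := by norm_num
    rw [this, Real.rpow_neg_one]; ring
  linarith

lemma eventually_moment_le (H : IsEvolution α m c κ k Φ q) {c' h : ℝ} (hc : c < c') (hh : 0 < h) :
    ∀ᶠ T in atTop, ∫ u in (0:ℝ)..h * T, u * k u ≤ c' * Real.log T := by
  obtain ⟨d, hd1, hd2⟩ := exists_between hc
  have := eventually_integral_le_log_pow (g := fun u => u * k u) (b := d) 0
    (fun y hy => H.moment_intervalIntegrable hy)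
    (by
      filter_upwards [H.eventually_k_le hd1, eventually_gt_atTop 0] with u hu hu0
      calc u * k u ≤ u * (d / u ^ 2) := mul_le_mul_of_nonneg_left hu hu0.le
        _ = _ := by push_cast; field_simp; norm_num) hh hd2
  simpa using this

lemma eventually_le_moment (H : IsEvolution α m c κ k Φ q) {c' h : ℝ} (hc : c' < c) (hh : 0 < h) :
    ∀ᶠ T in atTop, c' * Real.log T ≤ ∫ u in (0:ℝ)..h * T, u * k u := by
  obtain ⟨d, hd1, hd2⟩ := exists_between hc
  have := eventually_log_pow_le_integral (g := fun u => u * k u) (b := d) 0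
    (fun y hy => H.moment_intervalIntegrable hy)
    (by
      filter_upwards [H.eventually_le_k hd2, eventually_gt_atTop 0] with u hu hu0
      calc _ = u * (d / u ^ 2) := by push_cast; field_simp; norm_num
        _ ≤ u * k u := mul_le_mul_of_nonneg_left hu hu0.le) hh hd1
  simpa using this

lemma eventually_integral_q_le (H : IsEvolution α m c κ k Φ q) {A A' h : ℝ} (hA : A < A')
    (hq : ∀ᶠ s in atTop, q s ≤ A * (Real.log s / s)) (hh : 0 < h) :
    ∀ᶠ T in atTop, ∫ s in (0:ℝ)..h * T, q s ≤ A' / 2 * Real.log T ^ 2 := by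
  refine eventually_integral_le_log_pow (b := A / 2) 1 (fun y _ => H.q_intervalIntegrable 0 y)
    ?_ hh (by linarith)
  filter_upwards [hq] with s hs
  refine hs.trans (le_of_eq ?_)
  push_cast; ring

lemma eventually_le_integral_q (H : IsEvolution α m c κ k Φ q) {A A' h : ℝ} (hA : A' < A)
    (hq : ∀ᶠ s in atTop, A * (Real.log s / s) ≤ q s) (hh : 0 < h) :
    ∀ᶠ T in atTop, A' / 2 * Real.log T ^ 2 ≤ ∫ s in (0:ℝ)..h * T, q s := by
  refine eventually_log_pow_le_integral (b := A / 2) 1 (fun y _ => H.q_intervalIntegrable 0 y)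
    ?_ hh (by linarith)
  filter_upwards [hq] with s hs
  refine le_trans (le_of_eq ?_) hs
  push_cast; ring

lemma comparison_integrable (H : IsEvolution α m c κ k Φ q) {D : ℝ → ℝ} (hD : Measurable D)
    {η B : ℝ} (hη : 0 ≤ η) (hB : ∀ u ∈ Set.Ioc 0 η, |D u| ≤ B) :
    IntervalIntegrable (fun u => k u * max (D u) 0) volume 0 η := by
  rw [intervalIntegrable_iff_integrableOn_Ioc_of_le hη]
  have hk : IntegrableOn k (Set.Ioc 0 η) := H.k_int.mono_set Set.Ioc_subset_Ioi_self
  refine Integrable.mono' (g := fun u => k u * B) (hk.mul_const _)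
    (H.k_meas.mul (hD.max measurable_const)).aestronglyMeasurable ?_
  filter_upwards [ae_restrict_mem measurableSet_Ioc] with u hu
  have hk0 := H.k_nonneg hu.1
  rw [Real.norm_of_nonneg (mul_nonneg hk0 (le_max_right _ _))]
  exact mul_le_mul_of_nonneg_left
    (max_le ((le_abs_self _).trans (hB u hu)) ((abs_nonneg _).trans (hB u hu))) hk0

/-- Two functions whose one-step images over lags in `(0, η]` are ordered in the integrated sense
remain ordered on `[a, b]` if they are ordered on the initial window `[a - η, a]`. -/
lemma comparison (H : IsEvolution α m c κ k Φ q) {v w : ℝ → ℝ} (hv : Measurable v)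
    (hw : Measurable w) {a b η B : ℝ} (hη : 0 ≤ η)
    (hvB : ∀ s ∈ Set.Icc (a - η) b, |v s| ≤ B) (hwB : ∀ s ∈ Set.Icc (a - η) b, |w s| ≤ B)
    (h0 : ∀ s ∈ Set.Icc (a - η) a, v s ≤ w s)
    (hle : ∀ t ∈ Set.Icc a b, v t - ∫ u in (0:ℝ)..η, netKernel α k Φ u (v (t - u)) ≤
      w t - ∫ u in (0:ℝ)..η, netKernel α k Φ u (w (t - u))) :
    ∀ t ∈ Set.Icc a b, v t ≤ w t := by
  have key := nonpos_of_le_integral_kernel (k := k) (D := fun s => v s - w s) (a := a) (b := b)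
    (η := η) (M := 2 * B) hη (H.k_intervalIntegrable le_rfl hη) (fun u => H.k_nonneg)
    (H.integral_k_lt_one hη) ?_ (fun s hs => sub_nonpos.2 (h0 s hs)) ?_
  · exact fun t ht => sub_nonpos.1 (key t ht)
  · intro t ht
    have hmem : ∀ u ∈ Set.Ioc 0 η, t - u ∈ Set.Icc (a - η) b := fun u hu =>
      ⟨by linarith [hu.2, ht.1], by linarith [hu.1, ht.2]⟩
    have hvt : Measurable fun u => v (t - u) := hv.comp (by fun_prop)
    have hwt : Measurable fun u => w (t - u) := hw.comp (by fun_prop)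
    have iv := H.netKernel_intervalIntegrable hvt le_rfl hη fun u hu => hvB _ (hmem u hu)
    have iw := H.netKernel_intervalIntegrable hwt le_rfl hη fun u hu => hwB _ (hmem u hu)
    have id := H.comparison_integrable (D := fun u => v (t - u) - w (t - u)) (hvt.sub hwt) hη
      (B := 2 * B) fun u hu => (abs_sub _ _).trans
        (by linarith [hvB _ (hmem u hu), hwB _ (hmem u hu)])
    have h1 : ∫ u in (0:ℝ)..η, (netKernel α k Φ u (v (t - u)) - netKernel α k Φ u (w (t - u)))
        ≤ ∫ u in (0:ℝ)..η, k u * max (v (t - u) - w (t - u)) 0 :=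
      intervalIntegral.integral_mono_on_of_le_Ioo hη (iv.sub iw) id
        fun u hu => H.netKernel_sub_le hu.1 _ _
    rw [intervalIntegral.integral_sub iv iw] at h1
    have h2 := hle t ht
    linarith
  · intro s hs
    have hs' : s ∈ Set.Icc (a - η) b := ⟨by linarith [hs.1], hs.2⟩
    have h1 := (abs_le.1 (hvB s hs')).2
    have h2 := (abs_le.1 (hwB s hs')).1
    linarith

lemma integral_netKernel_affine_le (H : IsEvolution α m c κ k Φ q) {x y σ η : ℝ} (hη : 0 ≤ η)
    (hx : 0 ≤ x) (hσ : 0 ≤ σ) (hy : y ≤ x) :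
    ∫ u in (0:ℝ)..η, netKernel α k Φ u (x + σ * u) ≤
      x + σ * (∫ u in (0:ℝ)..η, u * k u) - α * Φ y * (1 - Real.exp (-η)) := by
  have hα := H.α_pos
  have i1 := (H.k_intervalIntegrable le_rfl hη).const_mul x
  have i2 := (H.moment_intervalIntegrable hη).const_mul σ
  have i3 : IntervalIntegrable (fun u => α * Φ y * Real.exp (-u)) volume 0 η :=
    Continuous.intervalIntegrable (by fun_prop) _ _
  have iG := H.netKernel_intervalIntegrable (w := fun u => x + σ * u) (by fun_prop) le_rfl hη
    (B := x + σ * η) fun u hu => by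
      have := hu.1
      have := hu.2
      rw [abs_of_nonneg (by positivity)]
      gcongr
  have h1 : ∫ u in (0:ℝ)..η, netKernel α k Φ u (x + σ * u) ≤
      ∫ u in (0:ℝ)..η, (x * k u + σ * (u * k u) - α * Φ y * Real.exp (-u)) := by
    refine intervalIntegral.integral_mono_on_of_le_Ioo hη iG ((i1.add i2).sub i3) fun u hu => ?_
    have hΦ : Φ y ≤ Φ (x + σ * u) := H.Φ_mono (by have := mul_nonneg hσ hu.1.le; linarith)
    have := mul_le_mul_of_nonneg_left hΦ (mul_pos hα (Real.exp_pos (-u))).le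
    unfold netKernel
    linarith
  have h2 : ∫ u in (0:ℝ)..η, Real.exp (-u) = 1 - Real.exp (-η) := by
    simp [intervalIntegral.integral_comp_neg (fun u => Real.exp u)]
  rw [intervalIntegral.integral_sub (i1.add i2) i3, intervalIntegral.integral_add i1 i2,
    intervalIntegral.integral_const_mul, intervalIntegral.integral_const_mul,
    intervalIntegral.integral_const_mul, h2] at h1
  have := mul_le_mul_of_nonneg_left (H.integral_k_lt_one hη).le hx
  linarith

lemma le_integral_netKernel_affine (H : IsEvolution α m c κ k Φ q) {x z σ η : ℝ} (hη : 0 ≤ η)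
    (hx : 0 ≤ x) (hσ : 0 ≤ σ) (hz : x + σ * η ≤ z) :
    x * (∫ u in (0:ℝ)..η, k u) + σ * (∫ u in (0:ℝ)..η, u * k u) - α * Φ z ≤
      ∫ u in (0:ℝ)..η, netKernel α k Φ u (x + σ * u) := by
  have hα := H.α_pos
  have i1 := (H.k_intervalIntegrable le_rfl hη).const_mul x
  have i2 := (H.moment_intervalIntegrable hη).const_mul σ
  have i3 : IntervalIntegrable (fun u => α * Φ z * Real.exp (-u)) volume 0 η :=
    Continuous.intervalIntegrable (by fun_prop) _ _
  have iG := H.netKernel_intervalIntegrable (w := fun u => x + σ * u) (by fun_prop) le_rfl hη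
    (B := x + σ * η) fun u hu => by
      have := hu.1
      have := hu.2
      rw [abs_of_nonneg (by positivity)]
      gcongr
  have h1 : ∫ u in (0:ℝ)..η, (x * k u + σ * (u * k u) - α * Φ z * Real.exp (-u)) ≤
      ∫ u in (0:ℝ)..η, netKernel α k Φ u (x + σ * u) := by
    refine intervalIntegral.integral_mono_on_of_le_Ioo hη ((i1.add i2).sub i3) iG fun u hu => ?_
    have hΦ : Φ (x + σ * u) ≤ Φ z :=
      H.Φ_mono (by have := mul_le_mul_of_nonneg_left hu.2.le hσ; linarith)
    have := mul_le_mul_of_nonneg_left hΦ (mul_pos hα (Real.exp_pos (-u))).le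
    unfold netKernel
    linarith
  have h2 : ∫ u in (0:ℝ)..η, Real.exp (-u) = 1 - Real.exp (-η) := by
    simp [intervalIntegral.integral_comp_neg (fun u => Real.exp u)]
  rw [intervalIntegral.integral_sub (i1.add i2) i3, intervalIntegral.integral_add i1 i2,
    intervalIntegral.integral_const_mul, intervalIntegral.integral_const_mul,
    intervalIntegral.integral_const_mul, h2] at h1
  have hΦz : 0 ≤ Φ z := H.Φ_nonneg (le_trans (by positivity) hz)
  have : 0 ≤ α * Φ z * Real.exp (-η) := by positivity
  linarith

lemma tendsto_log_div_self : Tendsto (fun T : ℝ => Real.log T / T) atTop (𝓝 0) :=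
  Real.isLittleO_log_id_atTop.tendsto_div_nhds_zero

lemma tendsto_mul_log_div_self {B : ℝ} (hB : 0 < B) :
    Tendsto (fun T : ℝ => B * (Real.log T / T)) atTop (𝓝[>] 0) := by
  refine tendsto_nhdsWithin_iff.2 ⟨by simpa using tendsto_log_div_self.const_mul B, ?_⟩
  filter_upwards [eventually_gt_atTop 1] with T hT
  have := Real.log_pos hT
  exact Set.mem_Ioi.2 (by positivity)

lemma eventually_le_Φ (H : IsEvolution α m c κ k Φ q) {κ' B : ℝ} (hκ : κ' < κ) (hB : 0 < B) :
    ∀ᶠ T in atTop, κ' * (B * (Real.log T / T)) ^ 2 ≤ Φ (B * (Real.log T / T)) := by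
  have hev : ∀ᶠ x in 𝓝[>] (0:ℝ), κ' * x ^ 2 ≤ Φ x := by
    filter_upwards [H.Φ_quad.eventually_const_lt hκ, self_mem_nhdsWithin] with x hx hx0
    exact ((lt_div_iff₀ (pow_pos hx0 2)).1 hx).le
  exact (tendsto_mul_log_div_self hB).eventually hev

lemma eventually_Φ_le (H : IsEvolution α m c κ k Φ q) {κ' B : ℝ} (hκ : κ < κ') (hB : 0 < B) :
    ∀ᶠ T in atTop, Φ (B * (Real.log T / T)) ≤ κ' * (B * (Real.log T / T)) ^ 2 := by
  have hev : ∀ᶠ x in 𝓝[>] (0:ℝ), Φ x ≤ κ' * x ^ 2 := by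
    filter_upwards [H.Φ_quad.eventually_lt_const hκ, self_mem_nhdsWithin] with x hx hx0
    exact ((div_lt_iff₀ (pow_pos hx0 2)).1 hx).le
  exact (tendsto_mul_log_div_self hB).eventually hev

lemma eventually_error_le {b ε C : ℝ} (hb : 0 < b) (hε : 0 < ε) :
    ∀ᶠ T in atTop, Real.exp (-(b * T)) + C * (Real.log T / T ^ 2) ≤ ε * (Real.log T / T) ^ 2 := by
  have h1 : Tendsto (fun T : ℝ => (T ^ 2 * Real.exp (-b * T)) * (1 / Real.log T) ^ 2
      + C / Real.log T) atTop (𝓝 (0 * 0 ^ 2 + 0)) := by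
    refine Tendsto.add (Tendsto.mul ?_ (Tendsto.pow ?_ 2)) ?_
    · simpa using tendsto_rpow_mul_exp_neg_mul_atTop_nhds_zero 2 b hb
    · exact Real.tendsto_log_atTop.const_div_atTop _
    · exact Real.tendsto_log_atTop.const_div_atTop _
  filter_upwards [h1.eventually_lt_const (by simpa using hε : (0:ℝ) * 0 ^ 2 + 0 < ε),
    eventually_gt_atTop 1] with T hT hT1
  have hL := Real.log_pos hT1
  have hT0 : 0 < T := by linarith
  have := mul_le_mul_of_nonneg_right hT.le (by positivity : 0 ≤ (Real.log T / T) ^ 2)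
  refine le_trans (le_of_eq ?_) this
  rw [neg_mul]
  field_simp

/-- Contribution of the distant past to the evolution equation, from above. -/
lemma far_le (H : IsEvolution α m c κ k Φ q) {A c' h T t L : ℝ} (hh : 0 < h) (hh4 : h ≤ 1 / 4)
    (hT : 0 < T) (hc' : 0 < c') (hA : 0 < A) (hL : 0 < L)
    (hk : ∀ u, h * T ≤ u → k u ≤ c' / u ^ 2)
    (hq : ∀ s, h * T ≤ s → s ≤ T → q s ≤ A * (L / s)) (ht1 : (1 - h) * T ≤ t) (ht2 : t ≤ T) :
    ∫ s in (0:ℝ)..t - h * T, netKernel α k Φ (t - s) (q s) ≤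
      c' / ((1 - 2 * h) * T) ^ 2 * (∫ s in (0:ℝ)..h * T, q s)
        + c' * A / h ^ 3 * (L / T ^ 2) := by
  have hhT : 0 < h * T := by positivity
  have hmid : h * T ≤ t - h * T := by nlinarith
  have h12 : 0 < 1 - 2 * h := by linarith
  have i1 := H.far_intervalIntegrable (t := t) hhT.le (by linarith)
  have i2 := H.far_intervalIntegrable (t := t) hmid (by linarith)
  rw [← intervalIntegral.integral_add_adjacent_intervals i1 i2]
  refine add_le_add ?_ ?_
  · rw [← intervalIntegral.integral_const_mul]
    refine intervalIntegral.integral_mono_on_of_le_Ioo hhT.le i1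
      ((H.q_intervalIntegrable _ _).const_mul _) fun s hs => ?_
    have hts : (1 - 2 * h) * T ≤ t - s := by linarith [hs.2]
    have hpos : 0 < (1 - 2 * h) * T := by positivity
    refine (H.netKernel_le (H.q_nonneg s)).trans
      (mul_le_mul_of_nonneg_right ?_ (H.q_nonneg s))
    refine (hk _ (by linarith [hs.2])).trans ?_
    gcongr
  · have hle : ∫ s in h * T..t - h * T, netKernel α k Φ (t - s) (q s) ≤
        ∫ s in h * T..t - h * T, c' / (h * T) ^ 2 * (A * (L / (h * T))) := by
      refine intervalIntegral.integral_mono_on_of_le_Ioo hmid i2 (by simp) fun s hs => ?_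
      have hs1 := hs.1
      have hts : h * T ≤ t - s := by linarith [hs.2]
      refine (H.netKernel_le (H.q_nonneg s)).trans
        (mul_le_mul ?_ ?_ (H.q_nonneg s) (by positivity))
      · refine (hk _ hts).trans ?_
        gcongr
      · refine (hq s hs1.le (by linarith)).trans ?_
        gcongr
    refine hle.trans ?_
    rw [intervalIntegral.integral_const, smul_eq_mul]
    have hpos : 0 ≤ c' / (h * T) ^ 2 * (A * (L / (h * T))) := by positivity
    refine (mul_le_mul_of_nonneg_right (by linarith : t - h * T - h * T ≤ T) hpos).trans
      (le_of_eq ?_)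
    field_simp

/-- Contribution of the distant past to the evolution equation, from below. -/
lemma le_far (H : IsEvolution α m c κ k Φ q) {c' h T t : ℝ} (hh : 0 < h) (hh4 : h ≤ 1 / 4)
    (hT : 0 < T) (hc' : 0 < c')
    (hk : ∀ u, h * T ≤ u → c' / u ^ 2 ≤ k u - α * m * Real.exp (-u))
    (ht1 : (1 - h) * T ≤ t) (ht2 : t ≤ T) :
    c' / T ^ 2 * (∫ s in (0:ℝ)..h * T, q s) ≤
      ∫ s in (0:ℝ)..t - h * T, netKernel α k Φ (t - s) (q s) := by
  have hhT : 0 < h * T := by positivity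
  have hmid : h * T ≤ t - h * T := by nlinarith
  have i1 := H.far_intervalIntegrable (t := t) hhT.le (by linarith)
  have i2 := H.far_intervalIntegrable (t := t) hmid (by linarith)
  rw [← intervalIntegral.integral_add_adjacent_intervals i1 i2]
  have h2 : 0 ≤ ∫ s in h * T..t - h * T, netKernel α k Φ (t - s) (q s) :=
    intervalIntegral.integral_nonneg hmid fun s hs =>
      H.netKernel_nonneg (by linarith [hs.2]) (H.q_nonneg s)
  have h1 : c' / T ^ 2 * (∫ s in (0:ℝ)..h * T, q s) ≤
      ∫ s in (0:ℝ)..h * T, netKernel α k Φ (t - s) (q s) := by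
    rw [← intervalIntegral.integral_const_mul]
    refine intervalIntegral.integral_mono_on_of_le_Ioo hhT.le
      ((H.q_intervalIntegrable _ _).const_mul _) i1 fun s hs => ?_
    have hts : h * T ≤ t - s := by linarith [hs.2]
    refine le_trans (mul_le_mul_of_nonneg_right ?_ (H.q_nonneg s)) (H.le_netKernel (H.q_nonneg s))
    refine le_trans ?_ (hk _ hts)
    have : 0 < t - s := by linarith
    have : t - s ≤ T := by linarith [hs.1]
    gcongr
  linarith

/-- Comparison with an affine upper barrier on `[(1 - 2h) T, T]`. -/
lemma eventually_le_of_barrier (H : IsEvolution α m c κ k Φ q) {A A' B p h c' κ' : ℝ}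
    (hh : 0 < h) (hh4 : h ≤ 1 / 4) (hA0 : 0 < A) (hA : A < A') (hB : 0 < B) (hp : 0 < p)
    (hc : c < c') (hκ : κ' < κ)
    (hwin : ∀ y, h ≤ y → y ≤ 2 * h → A * (1 + y + 2 * y ^ 2) ≤ B + p * y)
    (hmain : h + p * c' + c' * (A' / 2) / (1 - 2 * h) ^ 2 ≤ α * (κ' * B ^ 2) * (1 - h))
    (hq : ∀ᶠ s in atTop, q s ≤ A * (Real.log s / s)) :
    ∀ᶠ T in atTop, q T ≤ B * (Real.log T / T) := by
  have hα := H.α_pos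
  have hc' : 0 < c' := H.c_pos.trans hc
  obtain ⟨U, hU⟩ := (H.eventually_k_le hc).exists_forall_of_atTop
  obtain ⟨S, hS⟩ := hq.exists_forall_of_atTop
  have hTU : ∀ᶠ T in atTop, U ≤ h * T :=
    (tendsto_id.const_mul_atTop hh).eventually_ge_atTop U
  have hTS : ∀ᶠ T in atTop, S ≤ h * T :=
    (tendsto_id.const_mul_atTop hh).eventually_ge_atTop S
  have hexp : ∀ᶠ T in atTop, Real.exp (-(h * T)) ≤ h :=
    ((Real.tendsto_exp_neg_atTop_nhds_zero.comp
      (tendsto_id.const_mul_atTop hh)).eventually_lt_const hh).mono fun T hT => hT.le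
  filter_upwards [hTU, hTS, hexp, eventually_gt_atTop 1, H.eventually_moment_le hc hh,
    H.eventually_integral_q_le hA hq hh, H.eventually_le_Φ hκ hB,
    eventually_error_le (b := 1 - h) (C := c' * A / h ^ 3) (by linarith) hh]
    with T hTU hTS hexp hT1 hmom hQ hΦ herr
  have hT0 : 0 < T := by linarith
  have hL := Real.log_pos hT1
  set L := Real.log T
  set ℓ := L / T with hℓ
  have hℓ0 : 0 < ℓ := by positivity
  have h12 : 0 < 1 - 2 * h := by linarith
  have hhT : 0 < h * T := by positivity
  have hqs : ∀ s, h * T ≤ s → s ≤ T → q s ≤ A * (L / s) := fun s hs1 hs2 => by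
    have hs0 : 0 < s := hhT.trans_le hs1
    refine (hS s (hTS.trans hs1)).trans ?_
    have := Real.log_le_log hs0 hs2
    gcongr
  have hhalf : h * T ≤ (1 - 2 * h) * T := mul_le_mul_of_nonneg_right (by linarith) hT0.le
  clear_value L
  set W : ℝ → ℝ := fun s => ℓ * (B + p * (1 - s / T)) with hW
  have hy : ∀ s, (1 - 2 * h) * T ≤ s → s ≤ T → 0 ≤ 1 - s / T ∧ 1 - s / T ≤ 2 * h := by
    intro s hs1 hs2
    rw [← le_div_iff₀ hT0] at hs1
    rw [← div_le_one₀ hT0] at hs2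
    constructor <;> linarith
  have hW0 : ∀ s, (1 - 2 * h) * T ≤ s → s ≤ T → 0 ≤ W s := fun s hs1 hs2 => by
    have := (hy s hs1 hs2).1
    positivity
  have hWT : W T = B * ℓ := by simp only [hW]; field_simp; ring
  have key := H.comparison (v := q) (w := W) (a := (1 - h) * T) (b := T) (η := h * T)
    (B := max 1 (ℓ * (B + p))) H.q_meas (by fun_prop) hhT.le
    (fun s _ => (H.abs_q_le s).trans (le_max_left _ _)) ?_ ?_ ?_
  · rw [← hWT]
    exact key T ⟨by linarith, le_rfl⟩
  · intro s hs
    have hs1 : (1 - 2 * h) * T ≤ s := by linarith [hs.1]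
    refine le_trans ?_ (le_max_right _ _)
    rw [abs_of_nonneg (hW0 s hs1 hs.2)]
    have := (hy s hs1 hs.2).2
    have : p * (1 - s / T) ≤ p * 1 := by gcongr; linarith
    simp only [hW]
    gcongr
    linarith
  · intro s hs
    have hs1 : (1 - 2 * h) * T ≤ s := by linarith [hs.1]
    have hs2 : s ≤ T := by linarith [hs.2]
    obtain ⟨hy0, hy2⟩ := hy s hs1 hs2
    have hy1 : h ≤ 1 - s / T := by
      have := hs.2
      rw [← div_le_iff₀ hT0] at this
      linarith
    have hs0 : 0 < s := lt_of_lt_of_le (by positivity) hs1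
    refine (hqs s (hhalf.trans hs1) hs2).trans ?_
    have hsy : L / s = ℓ * (1 / (1 - (1 - s / T))) := by rw [hℓ, sub_sub_cancel]; field_simp
    clear_value ℓ
    set y := 1 - s / T
    have hinv : 1 / (1 - y) ≤ 1 + y + 2 * y ^ 2 := by
      rw [div_le_iff₀ (by linarith)]
      nlinarith [mul_nonneg (sq_nonneg y) (by linarith : 0 ≤ 1 - 2 * y)]
    rw [hsy]
    calc A * (ℓ * (1 / (1 - y))) = ℓ * (A * (1 / (1 - y))) := by ring
      _ ≤ ℓ * (A * (1 + y + 2 * y ^ 2)) := by gcongr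
      _ ≤ ℓ * (B + p * y) := by gcongr; exact hwin y hy1 hy2
  · intro t ht
    have ht1 := ht.1
    have ht2 := ht.2
    have hlag : h * T ≤ t := by linarith
    have ht3 : (1 - 2 * h) * T ≤ t := by linarith
    have hsplit := H.eqn_split hhT.le hlag
    have hfar := H.far_le hh hh4 hT0 hc' hA0 hL (fun u hu => hU u (hTU.trans hu)) hqs ht1 ht2
    have hWt : 0 ≤ W t := hW0 t ht3 ht2
    have hyt := (hy t ht3 ht2).1
    have hloc := H.integral_netKernel_affine_le (x := W t) (y := B * ℓ) (σ := p * ℓ / T) hhT.le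
      hWt (by positivity) (by
        have : 0 ≤ ℓ * (p * (1 - t / T)) := by positivity
        simp only [hW]
        linarith)
    have hfun : (fun u => netKernel α k Φ u (W (t - u)))
        = fun u => netKernel α k Φ u (W t + p * ℓ / T * u) := by
      funext u
      congr 1
      simp only [hW]
      field_simp
      ring
    rw [hfun]
    have hexpt : Real.exp (-t) ≤ Real.exp (-((1 - h) * T)) := Real.exp_le_exp.2 (by linarith)
    have hmom' : p * ℓ / T * (∫ u in (0:ℝ)..h * T, u * k u) ≤ p * c' * ℓ ^ 2 := by
      refine (mul_le_mul_of_nonneg_left hmom (by positivity)).trans (le_of_eq ?_)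
      rw [hℓ]; field_simp
    have hQ' : c' / ((1 - 2 * h) * T) ^ 2 * (∫ s in (0:ℝ)..h * T, q s) ≤
        c' * (A' / 2) / (1 - 2 * h) ^ 2 * ℓ ^ 2 := by
      refine (mul_le_mul_of_nonneg_left hQ (by positivity)).trans (le_of_eq ?_)
      rw [hℓ]; field_simp
    have hΦ0 : 0 ≤ Φ (B * ℓ) := H.Φ_nonneg (by positivity)
    have hΦ' : α * (κ' * B ^ 2) * (1 - h) * ℓ ^ 2 ≤
        α * Φ (B * ℓ) * (1 - Real.exp (-(h * T))) := by
      calc α * (κ' * B ^ 2) * (1 - h) * ℓ ^ 2 = α * (κ' * (B * ℓ) ^ 2) * (1 - h) := by ring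
        _ ≤ α * Φ (B * ℓ) * (1 - h) := by gcongr; linarith
        _ ≤ _ := by gcongr
    have hmain' := mul_le_mul_of_nonneg_right hmain (sq_nonneg ℓ)
    linarith

/-- Comparison with an affine lower barrier on `[(1 - 2h) T, T]`. -/
lemma eventually_barrier_le (H : IsEvolution α m c κ k Φ q) {A A' B p h c' κ' : ℝ}
    (hh : 0 < h) (hh4 : h ≤ 1 / 4) (hA0 : 0 < A') (hA : A' < A) (hB : 0 < B) (hp : 0 < p)
    (hc0 : 0 < c') (hc : c' < c) (hκ : κ < κ')
    (hwin : ∀ y, h ≤ y → y ≤ 2 * h → B + p * y ≤ A' * (1 + y))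
    (hmain : h + α * (κ' * (B + 2 * h * p) ^ 2) ≤ p * c' + c' * (A' / 2))
    (hq : ∀ᶠ s in atTop, A * (Real.log s / s) ≤ q s) :
    ∀ᶠ T in atTop, B * (Real.log T / T) ≤ q T := by
  have hα := H.α_pos
  have hcpos := H.c_pos
  have h12 : 0 < 1 - 2 * h := by linarith
  have hz0 : 0 < B + 2 * h * p := by positivity
  obtain ⟨U, hU⟩ := (H.eventually_le_k_sub_exp hc).exists_forall_of_atTop
  obtain ⟨S, hS⟩ := hq.exists_forall_of_atTop
  have hscale : Tendsto (fun T : ℝ => h * T) atTop atTop := tendsto_id.const_mul_atTop hh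
  have hTU : ∀ᶠ T in atTop, U ≤ h * T := hscale.eventually_ge_atTop U
  have hTS : ∀ᶠ T in atTop, S ≤ h * T := hscale.eventually_ge_atTop S
  have hlog : ∀ᶠ T in atTop, A' < A * (Real.log ((1 - 2 * h) * T) / Real.log T) :=
    ((tendsto_log_mul_div_log h12).const_mul A).eventually_const_lt (by simpa using hA)
  filter_upwards [hTU, hTS, hlog, eventually_gt_atTop 1, H.eventually_le_moment hc hh,
    H.eventually_le_integral_q hA hq hh, H.eventually_Φ_le hκ hz0,
    hscale.eventually (H.eventually_one_sub_le (show c < 2 * c by linarith)),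
    eventually_error_le (b := 1) (C := (B + p) * (2 * c) / h) one_pos hh]
    with T hTU hTS hlog hT1 hmom hQ hΦ htail herr
  have hT0 : 0 < T := by linarith
  have hL := Real.log_pos hT1
  set L := Real.log T
  set ℓ := L / T with hℓ
  have hℓ0 : 0 < ℓ := by positivity
  have hhT : 0 < h * T := by positivity
  have hhalf : h * T ≤ (1 - 2 * h) * T := mul_le_mul_of_nonneg_right (by linarith) hT0.le
  have hqs : ∀ s, (1 - 2 * h) * T ≤ s → A' * (L / s) ≤ q s := fun s hs1 => by
    have hs0 : 0 < s := hhT.trans_le (hhalf.trans hs1)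
    refine le_trans ?_ (hS s (hTS.trans (hhalf.trans hs1)))
    have h1 := Real.log_le_log (by positivity) hs1
    rw [← mul_div_assoc, lt_div_iff₀ hL] at hlog
    rw [← mul_div_assoc, ← mul_div_assoc]
    refine div_le_div_of_nonneg_right (hlog.le.trans ?_) hs0.le
    have : 0 < A := hA0.trans hA
    gcongr
  clear_value L
  set W : ℝ → ℝ := fun s => ℓ * (B + p * (1 - s / T)) with hW
  have hy : ∀ s, (1 - 2 * h) * T ≤ s → s ≤ T → 0 ≤ 1 - s / T ∧ 1 - s / T ≤ 2 * h := by
    intro s hs1 hs2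
    rw [← le_div_iff₀ hT0] at hs1
    rw [← div_le_one₀ hT0] at hs2
    constructor <;> linarith
  have hW0 : ∀ s, (1 - 2 * h) * T ≤ s → s ≤ T → 0 ≤ W s ∧ W s ≤ ℓ * (B + p) :=
    fun s hs1 hs2 => by
      obtain ⟨hy0, hy2⟩ := hy s hs1 hs2
      refine ⟨by positivity, ?_⟩
      have : p * (1 - s / T) ≤ p * 1 := by gcongr; linarith
      simp only [hW]
      gcongr
      linarith
  have hWT : W T = B * ℓ := by simp only [hW]; field_simp; ring
  have key := H.comparison (v := W) (w := q) (a := (1 - h) * T) (b := T) (η := h * T)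
    (B := max 1 (ℓ * (B + p))) (by fun_prop) H.q_meas hhT.le ?_
    (fun s _ => (H.abs_q_le s).trans (le_max_left _ _)) ?_ ?_
  · rw [← hWT]
    exact key T ⟨by linarith, le_rfl⟩
  · intro s hs
    obtain ⟨h1, h2⟩ := hW0 s (by linarith [hs.1]) hs.2
    rw [abs_of_nonneg h1]
    exact h2.trans (le_max_right _ _)
  · intro s hs
    have hs1 : (1 - 2 * h) * T ≤ s := by linarith [hs.1]
    have hs2 : s ≤ T := by linarith [hs.2]
    obtain ⟨hy0, hy2⟩ := hy s hs1 hs2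
    have hy1 : h ≤ 1 - s / T := by
      have := hs.2
      rw [← div_le_iff₀ hT0] at this
      linarith
    have hs0 : 0 < s := lt_of_lt_of_le (by positivity) hs1
    refine le_trans ?_ (hqs s hs1)
    have hsy : L / s = ℓ * (1 / (1 - (1 - s / T))) := by rw [hℓ, sub_sub_cancel]; field_simp
    clear_value ℓ
    simp only [hW]
    set y := 1 - s / T
    have hinv : 1 + y ≤ 1 / (1 - y) := by
      rw [le_div_iff₀ (by linarith)]
      nlinarith [sq_nonneg y]
    rw [hsy]
    calc ℓ * (B + p * y) ≤ ℓ * (A' * (1 + y)) := by gcongr; exact hwin y hy1 hy2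
      _ ≤ ℓ * (A' * (1 / (1 - y))) := by gcongr
      _ = A' * (ℓ * (1 / (1 - y))) := by ring
  · intro t ht
    have ht1 := ht.1
    have ht2 := ht.2
    have hlag : h * T ≤ t := by linarith
    have ht3 : (1 - 2 * h) * T ≤ t := by linarith
    have hsplit := H.eqn_split hhT.le hlag
    have hfar := H.le_far hh hh4 hT0 hc0 (fun u hu => hU u (hTU.trans hu)) ht1 ht2
    obtain ⟨hWt, hWt'⟩ := hW0 t ht3 ht2
    have hyt : 1 - t / T ≤ h := by
      rw [← le_div_iff₀ hT0] at ht1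
      linarith
    have hloc := H.le_integral_netKernel_affine (x := W t) (z := (B + 2 * h * p) * ℓ)
      (σ := p * ℓ / T) hhT.le hWt (by positivity) (by
        have h1 : p * ℓ / T * (h * T) = ℓ * (p * h) := by field_simp
        have h2 : ℓ * (p * (1 - t / T)) ≤ ℓ * (p * h) := by gcongr
        rw [h1]
        simp only [hW]
        linarith)
    have hfun : (fun u => netKernel α k Φ u (W (t - u)))
        = fun u => netKernel α k Φ u (W t + p * ℓ / T * u) := by
      funext u
      congr 1
      simp only [hW]
      field_simp
      ring
    rw [hfun]
    have hmom' : p * c' * ℓ ^ 2 ≤ p * ℓ / T * (∫ u in (0:ℝ)..h * T, u * k u) := by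
      refine le_trans (le_of_eq ?_) (mul_le_mul_of_nonneg_left hmom (by positivity))
      rw [hℓ]; field_simp
    have hQ' : c' * (A' / 2) * ℓ ^ 2 ≤ c' / T ^ 2 * (∫ s in (0:ℝ)..h * T, q s) := by
      refine le_trans (le_of_eq ?_) (mul_le_mul_of_nonneg_left hQ (by positivity))
      rw [hℓ]; field_simp
    have hΦ' : α * Φ ((B + 2 * h * p) * ℓ) ≤ α * (κ' * (B + 2 * h * p) ^ 2) * ℓ ^ 2 := by
      calc _ ≤ α * (κ' * ((B + 2 * h * p) * ℓ) ^ 2) := by gcongr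
        _ = _ := by ring
    have hloss : W t * (1 - ∫ u in (0:ℝ)..h * T, k u) ≤
        (B + p) * (2 * c) / h * (L / T ^ 2) := by
      calc _ ≤ ℓ * (B + p) * (2 * c / (h * T)) :=
            mul_le_mul hWt' (by linarith) (by linarith [H.integral_k_lt_one hhT.le])
              (by positivity)
        _ = _ := by rw [hℓ]; field_simp
    have hmain' := mul_le_mul_of_nonneg_right hmain (sq_nonneg ℓ)
    have := Real.exp_pos (-t)
    have := Real.exp_pos (-(1 * T))
    linarith

/-- An eventual upper bound above the critical constant can be improved. -/
lemma exists_improved_upper (H : IsEvolution α m c κ k Φ q) {A : ℝ} (hA0 : 0 < A)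
    (hA : 3 / 2 * c < α * κ * A)
    (hq : ∀ A' > A, ∀ᶠ s in atTop, q s ≤ A' * (Real.log s / s)) :
    ∃ B < A, ∀ᶠ T in atTop, q T ≤ B * (Real.log T / T) := by
  have h1 : ∀ᶠ h : ℝ in 𝓝 0,
      h + ((A + h ^ 2) * (1 + 4 * h) + 3 * h) * (c + h)
        + (c + h) * ((A + 2 * h ^ 2) / 2) / (1 - 2 * h) ^ 2
        < α * ((κ - h) * (A - 2 * h ^ 2) ^ 2) * (1 - h) := by
    refine ContinuousAt.eventually_lt ?_ ?_ ?_
    · fun_prop (disch := norm_num)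
    · fun_prop
    · norm_num
      nlinarith
  have h2 : ∀ᶠ h : ℝ in 𝓝 0, 0 < A - 2 * h ^ 2 :=
    ContinuousAt.eventually_lt (by fun_prop) (by fun_prop) (by simpa using hA0)
  have h3 : ∀ᶠ h : ℝ in 𝓝 0, h < 1 / 4 := eventually_lt_nhds (by norm_num)
  obtain ⟨h, ⟨hmain, hB, hh4⟩, hh⟩ :=
    (((h1.and (h2.and h3)).filter_mono nhdsWithin_le_nhds).and
      (self_mem_nhdsWithin (s := Set.Ioi (0:ℝ)))).exists
  have hhsq : 0 < h ^ 2 := by positivity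
  refine ⟨A - 2 * h ^ 2, by linarith, H.eventually_le_of_barrier (A := A + h ^ 2)
    (A' := A + 2 * h ^ 2) (p := (A + h ^ 2) * (1 + 4 * h) + 3 * h) (c' := c + h) (κ' := κ - h)
    hh hh4.le (by positivity) (by linarith) hB (by positivity) (by linarith) (by linarith) ?_
    hmain.le (hq _ (by linarith))⟩
  intro y hy1 hy2
  have hy0 : 0 ≤ y := by linarith
  have e1 : 0 ≤ (A + h ^ 2) * y * (2 * h - y) := by
    have : 0 ≤ 2 * h - y := by linarith
    positivity
  have e2 : 0 ≤ h * (y - h) := mul_nonneg hh.le (by linarith)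
  nlinarith

/-- An eventual lower bound below the critical constant can be improved. -/
lemma exists_improved_lower (H : IsEvolution α m c κ k Φ q) {A : ℝ} (hA0 : 0 < A)
    (hA : α * κ * A < 3 / 2 * c)
    (hq : ∀ A' < A, ∀ᶠ s in atTop, A' * (Real.log s / s) ≤ q s) :
    ∃ B > A, ∀ᶠ T in atTop, B * (Real.log T / T) ≤ q T := by
  have hcpos := H.c_pos
  have h1 : ∀ᶠ h : ℝ in 𝓝 0,
      h + α * ((κ + h) * ((A + 2 * h ^ 2) + 2 * h * (A - 2 * h ^ 2 - 4 * h)) ^ 2)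
        < (A - 2 * h ^ 2 - 4 * h) * (c - h) + (c - h) * ((A - 2 * h ^ 2) / 2) := by
    refine ContinuousAt.eventually_lt ?_ ?_ ?_
    · fun_prop
    · fun_prop
    · norm_num
      nlinarith
  have h2 : ∀ᶠ h : ℝ in 𝓝 0, 0 < A - 2 * h ^ 2 - 4 * h :=
    ContinuousAt.eventually_lt (by fun_prop) (by fun_prop) (by simpa using hA0)
  have h3 : ∀ᶠ h : ℝ in 𝓝 0, h < 1 / 4 := eventually_lt_nhds (by norm_num)
  have h4 : ∀ᶠ h : ℝ in 𝓝 0, h < c := eventually_lt_nhds hcpos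
  obtain ⟨h, ⟨hmain, hp, hh4, hhc⟩, hh⟩ :=
    (((h1.and (h2.and (h3.and h4))).filter_mono nhdsWithin_le_nhds).and
      (self_mem_nhdsWithin (s := Set.Ioi (0:ℝ)))).exists
  have hhsq : 0 < h ^ 2 := by positivity
  refine ⟨A + 2 * h ^ 2, by linarith, H.eventually_barrier_le (A := A - h ^ 2)
    (A' := A - 2 * h ^ 2) (p := A - 2 * h ^ 2 - 4 * h) (c' := c - h) (κ' := κ + h)
    hh hh4.le (by linarith) (by linarith) (by positivity) hp (by linarith) (by linarith)
    (by linarith) ?_ hmain.le (hq _ (by linarith))⟩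
  intro y hy1 hy2
  have e2 : 0 ≤ h * (y - h) := mul_nonneg hh.le (by linarith)
  nlinarith

end IsEvolution

/-- A function whose eventual upper bounds above `C` and eventual lower bounds in `(0, C)` can all
be improved converges to `C`. -/
lemma tendsto_of_improvable_bounds {g : ℝ → ℝ} {C a M : ℝ} (ha : 0 < a)
    (hM : ∀ᶠ t in atTop, g t ≤ M) (hm : ∀ b < a, ∀ᶠ t in atTop, b ≤ g t)
    (hup : ∀ A > C, 0 < A → (∀ A' > A, ∀ᶠ t in atTop, g t ≤ A') → ∃ B < A, ∀ᶠ t in atTop, g t ≤ B)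
    (hlo : ∀ A < C, 0 < A → (∀ A' < A, ∀ᶠ t in atTop, A' ≤ g t) →
      ∃ B > A, ∀ᶠ t in atTop, B ≤ g t) :
    Tendsto g atTop (𝓝 C) := by
  have hcross : ∀ {x y : ℝ}, (∀ᶠ t in atTop, x ≤ g t) → (∀ᶠ t in atTop, g t ≤ y) → x ≤ y :=
    fun h1 h2 => let ⟨_, h⟩ := (h1.and h2).exists; h.1.trans h.2
  set S := {x : ℝ | ∀ᶠ t in atTop, g t ≤ x}
  set R := {x : ℝ | ∀ᶠ t in atTop, x ≤ g t}
  have hSne : S.Nonempty := ⟨M, hM⟩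
  have hRne : R.Nonempty := ⟨a - 1, hm _ (by linarith)⟩
  have hSbdd : BddBelow S := ⟨a - 1, fun x hx => hcross (hm _ (by linarith)) hx⟩
  have hRbdd : BddAbove R := ⟨M, fun x hx => hcross hx hM⟩
  have hSinf : ∀ A' > sInf S, ∀ᶠ t in atTop, g t ≤ A' := fun A' hA' => by
    obtain ⟨x, hx, hxA⟩ := (csInf_lt_iff hSbdd hSne).1 hA'
    exact hx.mono fun t ht => ht.trans hxA.le
  have hRsup : ∀ A' < sSup R, ∀ᶠ t in atTop, A' ≤ g t := fun A' hA' => by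
    obtain ⟨x, hx, hxA⟩ := (lt_csSup_iff hRbdd hRne).1 hA'
    exact hx.mono fun t ht => hxA.le.trans ht
  have haR : a ≤ sSup R := le_of_forall_lt fun b hb => by
    obtain ⟨d, hd1, hd2⟩ := exists_between hb
    exact hd1.trans_le (le_csSup hRbdd (hm d hd2))
  have haS : a ≤ sInf S := le_of_forall_lt fun b hb => by
    obtain ⟨d, hd1, hd2⟩ := exists_between hb
    exact hd1.trans_le (le_csInf hSne fun x hx => hcross (hm d hd2) hx)
  have hS : sInf S ≤ C := by
    by_contra! hlt
    obtain ⟨B, hB, hgB⟩ := hup _ hlt (ha.trans_le haS) hSinf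
    exact absurd (csInf_le hSbdd hgB) (not_le.2 hB)
  have hR : C ≤ sSup R := by
    by_contra! hlt
    obtain ⟨B, hB, hgB⟩ := hlo _ hlt (ha.trans_le haR) hRsup
    exact absurd (le_csSup hRbdd hgB) (not_le.2 hB)
  refine tendsto_order.2 ⟨fun x hx => ?_, fun x hx => ?_⟩
  · obtain ⟨d, hd1, hd2⟩ := exists_between (hx.trans_le hR)
    exact (hRsup d hd2).mono fun t ht => hd1.trans_le ht
  · obtain ⟨d, hd1, hd2⟩ := exists_between (hS.trans_lt hx)
    exact (hSinf d hd1).mono fun t ht => ht.trans_lt hd2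

theorem IsEvolution.tendsto_mul_div_log {α m c κ : ℝ} {k Φ q : ℝ → ℝ}
    (H : IsEvolution α m c κ k Φ q) {a M : ℝ} (ha : 0 < a)
    (hm : ∀ b < a, ∀ᶠ t in atTop, b ≤ t * q t / Real.log t)
    (hM : ∀ᶠ t in atTop, t * q t / Real.log t ≤ M) :
    Tendsto (fun t : ℝ => t * q t / Real.log t) atTop (𝓝 (3 * c / (2 * (α * κ)))) := by
  have hακ : 0 < α * κ := mul_pos H.α_pos H.κ_pos
  have hle : ∀ x : ℝ, (∀ᶠ t in atTop, t * q t / Real.log t ≤ x) ↔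
      ∀ᶠ t in atTop, q t ≤ x * (Real.log t / t) := fun x => by
    refine eventually_congr ?_
    filter_upwards [eventually_gt_atTop 1] with t ht
    have := Real.log_pos ht
    rw [div_le_iff₀ this, ← mul_div_assoc, le_div_iff₀' (by linarith)]
  have hge : ∀ x : ℝ, (∀ᶠ t in atTop, x ≤ t * q t / Real.log t) ↔
      ∀ᶠ t in atTop, x * (Real.log t / t) ≤ q t := fun x => by
    refine eventually_congr ?_
    filter_upwards [eventually_gt_atTop 1] with t ht
    have := Real.log_pos ht
    rw [le_div_iff₀ this, ← mul_div_assoc, div_le_iff₀' (by linarith)]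
  refine tendsto_of_improvable_bounds ha hM hm ?_ ?_
  · intro A hA hA0 hbd
    simp only [hle] at hbd ⊢
    refine H.exists_improved_upper hA0 ?_ hbd
    rw [gt_iff_lt, div_lt_iff₀ (by positivity)] at hA
    linarith
  · intro A hA hA0 hbd
    simp only [hge] at hbd ⊢
    refine H.exists_improved_lower hA0 ?_ hbd
    rw [lt_div_iff₀ (by positivity)] at hA
    linarith

lemma pow_sub_pow_le_mul_sub {a b : ℝ} (hb : 0 ≤ b) (hab : b ≤ a) (ha : a ≤ 1) (n : ℕ) :
    a ^ n - b ^ n ≤ n * (a - b) := by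
  induction n with
  | zero => simp
  | succ n ih =>
    have h1 : b ^ n ≤ 1 := pow_le_one₀ hb (hab.trans ha)
    have h2 : 0 ≤ a ^ n - b ^ n := sub_nonneg.2 (pow_le_pow_left₀ hb hab n)
    have h3 := mul_le_mul_of_nonneg_right ha h2
    have h4 := mul_le_mul_of_nonneg_left h1 (sub_nonneg.2 hab)
    push_cast
    linarith [show a ^ (n + 1) - b ^ (n + 1) = a * (a ^ n - b ^ n) + (a - b) * b ^ n by ring]

lemma one_sub_pow_remainder_nonneg {x : ℝ} (hx1 : x ≤ 1) (n : ℕ) :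
    0 ≤ (1 - x) ^ n - 1 + n * x := by
  have := one_add_mul_le_pow (a := -x) (by linarith) n
  rw [← sub_eq_add_neg] at this
  linarith

lemma one_sub_pow_remainder_le {x : ℝ} (hx0 : 0 ≤ x) (hx1 : x ≤ 1) (n : ℕ) :
    (1 - x) ^ n - 1 + n * x ≤ n * (n - 1) / 2 * x ^ 2 := by
  induction n with
  | zero => simp
  | succ n ih =>
    have h := mul_le_mul_of_nonneg_left (one_sub_pow_remainder_nonneg hx1 n) hx0
    push_cast
    linarith [show (1 - x) ^ (n + 1) = (1 - x) ^ n - x * (1 - x) ^ n by ring]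

lemma tendsto_one_sub_pow_remainder (n : ℕ) :
    Tendsto (fun x : ℝ => ((1 - x) ^ n - 1 + n * x) / x ^ 2) (𝓝[>] 0)
      (𝓝 ((n : ℝ) * ((n : ℝ) - 1) / 2)) := by
  induction n with
  | zero => simp
  | succ n ih =>
    have hid : Tendsto (fun x : ℝ => x) (𝓝[>] 0) (𝓝 0) := tendsto_id.mono_left nhdsWithin_le_nhds
    have h := ih.add ((hid.mul ih).const_sub (n : ℝ))
    have hval : (n : ℝ) * (n - 1) / 2 + (n - 0 * (n * (n - 1) / 2)) =
        ((n + 1 : ℕ) : ℝ) * (((n + 1 : ℕ) : ℝ) - 1) / 2 := by push_cast; ring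
    rw [hval] at h
    refine h.congr' ?_
    filter_upwards [self_mem_nhdsWithin] with x hx
    have : x ≠ 0 := (Set.mem_Ioi.1 hx).ne'
    push_cast
    field_simp
    ring

/-- The defect `m x - (1 - f(1 - x))` of the generating function with coefficients `f`. -/
noncomputable def genDefect (f : ℕ → ℝ) (m x : ℝ) : ℝ :=
  m * x - (1 - ∑' k : ℕ, f k * (1 - x) ^ k)

section genDefect

variable {f : ℕ → ℝ} {m : ℝ}

lemma summable_mul_one_sub_pow (hf : ∀ k, 0 ≤ f k) (hfs : Summable f) {x : ℝ}
    (hx : x ∈ Set.Icc (0:ℝ) 1) : Summable fun k => f k * (1 - x) ^ k := by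
  have h0 : 0 ≤ 1 - x := by linarith [hx.2]
  refine hfs.of_nonneg_of_le (fun k => mul_nonneg (hf k) (pow_nonneg h0 k)) fun k => ?_
  exact mul_le_of_le_one_right (hf k) (pow_le_one₀ h0 (by linarith [hx.1]))

lemma genDefect_sub_mem (hf : ∀ k, 0 ≤ f k) (hfs : Summable f)
    (hm : HasSum (fun k : ℕ => (k : ℝ) * f k) m) {x y : ℝ}
    (hy : 0 ≤ y) (hyx : y ≤ x) (hx : x ≤ 1) :
    genDefect f m x - genDefect f m y ∈ Set.Icc 0 (m * (x - y)) := by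
  have sx := summable_mul_one_sub_pow hf hfs ⟨hy.trans hyx, hx⟩
  have sy := summable_mul_one_sub_pow hf hfs ⟨hy, hyx.trans hx⟩
  have hsub := sy.hasSum.sub sx.hasSum
  have h1 : 0 ≤ ∑' k, f k * (1 - y) ^ k - ∑' k, f k * (1 - x) ^ k :=
    hsub.nonneg fun k => sub_nonneg.2 <| mul_le_mul_of_nonneg_left
      (pow_le_pow_left₀ (by linarith) (by linarith) k) (hf k)
  have h2 : ∑' k, f k * (1 - y) ^ k - ∑' k, f k * (1 - x) ^ k ≤ m * (x - y) := by
    refine hasSum_le (fun k => ?_) hsub (hm.mul_right (x - y))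
    have := mul_le_mul_of_nonneg_left (pow_sub_pow_le_mul_sub (a := 1 - y) (b := 1 - x)
      (by linarith) (by linarith) (by linarith) k) (hf k)
    linarith
  unfold genDefect
  constructor <;> linarith

lemma tendsto_genDefect_div_sq {m₂ : ℝ} (hf : ∀ k, 0 ≤ f k) (hf1 : HasSum f 1)
    (hm : HasSum (fun k : ℕ => (k : ℝ) * f k) m)
    (hm₂ : HasSum (fun k : ℕ => (k : ℝ) * ((k : ℝ) - 1) * f k) m₂) :
    Tendsto (fun x => genDefect f m x / x ^ 2) (𝓝[>] 0) (𝓝 (m₂ / 2)) := by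
  have hbound : HasSum (fun k : ℕ => f k * ((k : ℝ) * (k - 1) / 2)) (m₂ / 2) := by
    have hfun : (fun k : ℕ => f k * ((k : ℝ) * (k - 1) / 2)) =
        fun k : ℕ => (k : ℝ) * ((k : ℝ) - 1) * f k / 2 := by
      funext k; ring
    rw [hfun]
    exact hm₂.div_const 2
  have hev : ∀ᶠ x : ℝ in 𝓝[>] 0, x ∈ Set.Ioo (0:ℝ) 1 := Ioo_mem_nhdsGT one_pos
  have h := tendsto_tsum_of_dominated_convergence (𝓕 := 𝓝[>] (0:ℝ))
    (f := fun x k => f k * (((1 - x) ^ k - 1 + k * x) / x ^ 2))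
    (g := fun k => f k * ((k : ℝ) * (k - 1) / 2)) hbound.summable
    (fun k => (tendsto_one_sub_pow_remainder k).const_mul (f k)) (by
      filter_upwards [hev] with x hx k
      have hx0 := hx.1
      have h1 := one_sub_pow_remainder_nonneg hx.2.le k
      have h2 := one_sub_pow_remainder_le hx0.le hx.2.le k
      rw [Real.norm_of_nonneg (mul_nonneg (hf k) (by positivity))]
      refine mul_le_mul_of_nonneg_left ?_ (hf k)
      rwa [div_le_iff₀ (by positivity)])
  rw [hbound.tsum_eq] at h
  refine h.congr' ?_
  filter_upwards [hev] with x hx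
  have sx := (summable_mul_one_sub_pow hf hf1.summable ⟨hx.1.le, hx.2.le⟩).hasSum
  have hs := ((sx.sub hf1).add (hm.mul_right x)).div_const (x ^ 2)
  have hfun : (fun k : ℕ => f k * (((1 - x) ^ k - 1 + k * x) / x ^ 2)) =
      fun k : ℕ => (f k * (1 - x) ^ k - f k + (k : ℝ) * f k * x) / x ^ 2 := by
    funext k; ring
  rw [hfun, hs.tsum_eq, genDefect]
  ring

end genDefect


/-- exact asymptotics: if q satisfies the basic evolution equation,
liminf t·q(t)/log t ≥ c₄/(α m₂) and limsup t·q(t)/log t < ∞, then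
t·q(t)/log t → C := 3c₄/(α m₂). -/
theorem survival_probability_exact_asymptotics
    (α : ℝ) (hα : α ∈ Set.Ioo (0:ℝ) 1)
    (f : ℕ → ℝ) (hf : ∀ k, 0 ≤ f k) (hfsum : ∑' k, f k = 1)
    (m₁ m₂ : ℝ) (hm₁pos : 0 < m₁) (hm₂pos : 0 < m₂)
    (hm₁sum : Summable fun k : ℕ => (k : ℝ) * f k)
    (hm₁ : ∑' k : ℕ, (k : ℝ) * f k = m₁)
    (hm₂sum : Summable fun k : ℕ => (k : ℝ) * ((k : ℝ) - 1) * f k)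
    (hm₂ : ∑' k : ℕ, (k : ℝ) * ((k : ℝ) - 1) * f k = m₂)
    (Ψ : ℝ → ℝ) (hΨ0 : Ψ 0 = 0)
    (hΨ : ∀ x ∈ Set.Ioc (0:ℝ) 1,
      Ψ x = (m₁ * x - (1 - ∑' k : ℕ, f k * (1 - x) ^ k)) / x)
    (mo : ℝ → ℝ) (hmo_meas : Measurable mo) (hmo_nonneg : ∀ u > (0:ℝ), 0 ≤ mo u)
    (k₄ : ℝ → ℝ) (hk₄ : ∀ u, k₄ u = α * m₁ * Real.exp (-u) + mo u)
    (hk₄int : ∫ u in Set.Ioi (0:ℝ), k₄ u = 1)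
    (c₄ : ℝ) (hc₄ : 0 < c₄)
    (hk₄tail : Tendsto (fun u : ℝ => u ^ 2 * k₄ u) atTop (nhds c₄))
    (q : ℝ → ℝ) (hq_meas : Measurable q) (hq01 : ∀ t, q t ∈ Set.Icc (0:ℝ) 1)
    (heq : ∀ t ≥ (0:ℝ), q t = Real.exp (-t) +
      ∫ u in Set.Ioc (0:ℝ) t,
        q (t - u) * (k₄ u - α * Ψ (q (t - u)) * Real.exp (-u)))
    (hliminf : ∀ ε > (0:ℝ), ∀ᶠ t in atTop,
      c₄ / (α * m₂) - ε ≤ t * q t / Real.log t)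
    (hlimsup : ∃ M : ℝ, ∀ᶠ t in atTop, t * q t / Real.log t ≤ M) :
    Tendsto (fun t : ℝ => t * q t / Real.log t) atTop
      (nhds (3 * c₄ / (α * m₂))) := by
  have hα0 := hα.1
  have hf1 : HasSum f 1 := by
    have hs : Summable f := by
      by_contra h
      rw [tsum_eq_zero_of_not_summable h] at hfsum
      exact zero_ne_one hfsum
    exact hfsum ▸ hs.hasSum
  have hm₁' : HasSum (fun k : ℕ => (k : ℝ) * f k) m₁ := hm₁ ▸ hm₁sum.hasSum
  have hm₂' : HasSum (fun k : ℕ => (k : ℝ) * ((k : ℝ) - 1) * f k) m₂ := hm₂ ▸ hm₂sum.hasSum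
  have hclamp : ∀ x : ℝ, max 0 (min x 1) ∈ Set.Icc (0:ℝ) 1 := fun x =>
    ⟨le_max_left _ _, max_le zero_le_one (min_le_right _ _)⟩
  have hclamp_eq : ∀ x ∈ Set.Icc (0:ℝ) 1, max 0 (min x 1) = x := fun x hx => by
    rw [min_eq_left hx.2, max_eq_right hx.1]
  have hclamp_mono : ∀ {x y : ℝ}, y ≤ x → max 0 (min y 1) ≤ max 0 (min x 1) := fun h =>
    max_le_max le_rfl (min_le_min h le_rfl)
  have hclamp_sub : ∀ {x y : ℝ}, y ≤ x → max 0 (min x 1) - max 0 (min y 1) ≤ x - y := by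
    intro x y h
    rcases max_cases 0 (min x 1) with h1 | h1 <;> rcases max_cases 0 (min y 1) with h2 | h2 <;>
      rcases min_cases x 1 with h3 | h3 <;> rcases min_cases y 1 with h4 | h4 <;> linarith
  set Φ : ℝ → ℝ := fun x => genDefect f m₁ (max 0 (min x 1)) with hΦ
  have hΦΨ : ∀ x ∈ Set.Icc (0:ℝ) 1, Φ x = x * Ψ x := by
    intro x hx
    simp only [hΦ, hclamp_eq x hx, genDefect]
    rcases hx.1.eq_or_lt with h0 | h0
    · subst h0
      simp [hfsum]
    · rw [hΨ x ⟨h0, hx.2⟩]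
      field_simp
  have H : IsEvolution α m₁ c₄ (m₂ / 2) k₄ Φ q :=
    { α_pos := hα0
      m_pos := hm₁pos
      c_pos := hc₄
      κ_pos := half_pos hm₂pos
      k_meas := by
        rw [funext hk₄]
        fun_prop
      k_int := by
        by_contra h
        rw [integral_undef h] at hk₄int
        exact zero_ne_one hk₄int
      k_one := hk₄int
      exp_le := fun u hu => by
        rw [hk₄]
        linarith [hmo_nonneg u hu]
      tail := hk₄tail
      Φ_mono := fun y x hyx => sub_nonneg.1 (genDefect_sub_mem hf hf1.summable hm₁'
        (hclamp y).1 (hclamp_mono hyx) (hclamp x).2).1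
      Φ_lip := fun x y hyx => (genDefect_sub_mem hf hf1.summable hm₁'
        (hclamp y).1 (hclamp_mono hyx) (hclamp x).2).2.trans
          (mul_le_mul_of_nonneg_left (hclamp_sub hyx) hm₁pos.le)
      Φ_zero := by rw [hΦΨ 0 ⟨le_rfl, zero_le_one⟩, zero_mul]
      Φ_quad := by
        refine (tendsto_genDefect_div_sq hf hf1 hm₁' hm₂').congr' ?_
        filter_upwards [Ioo_mem_nhdsGT (one_pos (α := ℝ))] with x hx
        simp only [hΦ, hclamp_eq x ⟨hx.1.le, hx.2.le⟩]
      q_meas := hq_meas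
      q_nonneg := fun t => (hq01 t).1
      q_le_one := fun t => (hq01 t).2
      eqn := fun t ht => by
        rw [heq t ht, intervalIntegral.integral_of_le ht]
        congr 2
        funext u
        rw [netKernel, hΦΨ _ (hq01 _)]
        ring }
  obtain ⟨M, hM⟩ := hlimsup
  have hlim := H.tendsto_mul_div_log (a := c₄ / (α * m₂)) (by positivity)
    (fun b hb => by simpa using hliminf (c₄ / (α * m₂) - b) (by linarith)) hM
  have hC : 3 * c₄ / (2 * (α * (m₂ / 2))) = 3 * c₄ / (α * m₂) := by
    congr 1
    ring
  rwa [hC] at hlim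
end

section
/- Fix an integer n ≥ 2, reals α > 0, c > 0, d₂ > 0 and d₃, …, d_n ≥ 0, and measurable functions P₁, …, P_{n−1} : [2,∞) → (0,∞) satisfying, for each 1 ≤ i ≤ n−1, lim_{t→∞} P_i(t)·log^{2i−1} t / t^{i−1} = i!·(α d₂/2)^{i−1}·c^{−(2i−1)}. Define H_n(t) := ∑_{k=2}^{n} d_k · ∑_{(j₁,…,j_{n−1}): j₁+⋯+j_{n−1}=k, j₁+2j₂+⋯+(n−1)j_{n−1}=n} (n!/(j₁!⋯j_{n−1}!)) · ∏_{i=1}^{n−1} (P_i(t)/i!)^{j_i}. Then lim_{t→∞} H_n(t)·log^{2n−2} t / t^{n−2} = n!·(d₂/2)·(α d₂/2)^{n−2}·(n−1)·c^{−(2n−2)}. -/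
open Filter

open Polynomial in
/-- The sum of `1 / ∏ (j i)!` over tuples of degree `2` and weight `m + 1` is `m / 2`; it is half the
coefficient of `X ^ (m + 1)` in `(X + ⋯ + X ^ m) ^ 2`. -/
theorem sum_inv_prod_factorial_antidiagonalTuple_two (m : ℕ) :
    ∑ j ∈ (Finset.Nat.antidiagonalTuple m 2).filter
        (fun j => ∑ i : Fin m, ((i : ℕ) + 1) * j i = m + 1),
      (1 / ∏ i : Fin m, ((j i).factorial : ℝ)) = (m : ℝ) / 2 := by
  have hset : Finset.Nat.antidiagonalTuple m 2 = Finset.piAntidiag Finset.univ 2 := by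
    ext j
    simp [Finset.Nat.mem_antidiagonalTuple]
  have h := congrArg (fun p : ℝ[X] => p.coeff (m + 1))
    (Finset.sum_pow_eq_sum_piAntidiag (Finset.univ : Finset (Fin m))
      (fun i : Fin m => (X : ℝ[X]) ^ ((i : ℕ) + 1)) 2)
  have hl : ((∑ i : Fin m, (X : ℝ[X]) ^ ((i : ℕ) + 1)) ^ 2).coeff (m + 1) = m := by
    have hinner : ∀ i : Fin m,
        ∑ l : Fin m, (if m + 1 = (i : ℕ) + 1 + ((l : ℕ) + 1) then (1 : ℝ) else 0) = 1 := by
      intro i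
      rw [Finset.sum_eq_single (Fin.rev i)]
      · rw [if_pos]
        have := i.isLt
        simp only [Fin.val_rev]
        omega
      · intro l _ hl
        rw [if_neg]
        intro h
        apply hl
        ext
        simp only [Fin.val_rev]
        omega
      · simp
    simp only [sq, Finset.sum_mul_sum, ← pow_add, finsetSum_coeff, coeff_X_pow, hinner]
    simp
  rw [hl] at h
  rw [h, hset, finsetSum_coeff, Finset.sum_filter, Finset.sum_div]
  refine Finset.sum_congr rfl fun j hj => ?_
  have hj2 : ∑ i, j i = 2 := by simpa using hj
  have hm := Nat.multinomial_spec Finset.univ j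
  rw [hj2] at hm
  have hm' : (∏ i, ((j i).factorial : ℝ)) * (Nat.multinomial Finset.univ j : ℝ) = 2 := by
    exact_mod_cast hm
  have hne : (∏ i, ((j i).factorial : ℝ)) ≠ 0 := by positivity
  simp only [← pow_mul, Finset.prod_pow_eq_pow_sum]
  rw [coeff_natCast_mul, coeff_X_pow]
  by_cases hw : ∑ i : Fin m, ((i : ℕ) + 1) * j i = m + 1
  · rw [if_pos hw, if_pos hw.symm]
    field_simp
    linarith
  · rw [if_neg hw, if_neg (Ne.symm hw)]
    simp

/-- In a monomial of degree `k` and weight `n`, scaling the variable of weight `i + 1` by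
`L ^ (2 * i + 1) / t ^ i` amounts to a total factor `L ^ (2 * n - k) / t ^ (n - k)`. -/
theorem prod_pow_mul_pow_div_pow {n m k : ℕ} (hk : 2 ≤ k) (x : Fin m → ℝ) (j : Fin m → ℕ)
    (hj : ∑ i, j i = k) (hw : ∑ i : Fin m, ((i : ℕ) + 1) * j i = n)
    (L : ℝ) {t : ℝ} (ht : t ≠ 0) :
    (∏ i, x i ^ j i) * L ^ (2 * n - 2) / t ^ (n - 2) =
      (∏ i : Fin m, (x i * L ^ (2 * (i : ℕ) + 1) / t ^ (i : ℕ)) ^ j i) * (L / t) ^ (k - 2) := by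
  simp only [add_mul, one_mul, Finset.sum_add_distrib, hj] at hw
  simp only [div_pow, mul_pow, ← pow_mul, Finset.prod_div_distrib, Finset.prod_mul_distrib,
    Finset.prod_pow_eq_pow_sum]
  simp only [add_mul, one_mul, mul_assoc, Finset.sum_add_distrib, ← Finset.mul_sum, hj]
  set s := ∑ i : Fin m, (i : ℕ) * j i
  have h1 : 2 * n - 2 = (2 * s + k) + (k - 2) := by omega
  have h2 : n - 2 = s + (k - 2) := by omega
  rw [h1, h2, pow_add, pow_add]
  field_simp
  ring

/-- A monomial of degree `2` and weight `n`, evaluated at `a ^ i / c ^ (2 * i + 1)`. -/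
theorem prod_pow_div_pow {n m : ℕ} (j : Fin m → ℕ)
    (hj : ∑ i, j i = 2) (hw : ∑ i : Fin m, ((i : ℕ) + 1) * j i = n) (a c : ℝ) :
    ∏ i : Fin m, (a ^ (i : ℕ) / c ^ (2 * (i : ℕ) + 1)) ^ j i =
      a ^ (n - 2) / c ^ (2 * n - 2) := by
  simp only [add_mul, one_mul, Finset.sum_add_distrib, hj] at hw
  simp only [div_pow, ← pow_mul, Finset.prod_div_distrib, Finset.prod_pow_eq_pow_sum]
  simp only [add_mul, one_mul, mul_assoc, Finset.sum_add_distrib, ← Finset.mul_sum, hj]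
  congr 2 <;> omega

/-- asymptotics of the Faa di Bruno sum
H_n(t) = ∑_{k=2}^n d_k ∑_{j₁+⋯+j_{n−1}=k, j₁+2j₂+⋯+(n−1)j_{n−1}=n}
  (n!/(j₁!⋯j_{n−1}!)) ∏ (P_i(t)/i!)^{j_i}:
H_n(t)·log^{2n−2}t / t^{n−2} → n!·(d₂/2)·(α d₂/2)^{n−2}·(n−1)/c^{2n−2}. -/
theorem faa_di_bruno_sum_asymptotics
    (n : ℕ) (hn : 2 ≤ n)
    (α c : ℝ) (hα : 0 < α) (hc : 0 < c)
    (d : ℕ → ℝ) (hd₂ : 0 < d 2)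
    (hd : ∀ k : ℕ, 3 ≤ k → k ≤ n → 0 ≤ d k)
    (P : ℕ → ℝ → ℝ)
    (hP_meas : ∀ i : ℕ, 1 ≤ i → i ≤ n - 1 → Measurable (P i))
    (hP_pos : ∀ i : ℕ, 1 ≤ i → i ≤ n - 1 → ∀ t ≥ (2:ℝ), 0 < P i t)
    (hP_lim : ∀ i : ℕ, 1 ≤ i → i ≤ n - 1 →
      Tendsto (fun t : ℝ => P i t * (Real.log t) ^ (2 * i - 1) / t ^ (i - 1))
        atTop (nhds ((i.factorial : ℝ) * (α * d 2 / 2) ^ (i - 1) / c ^ (2 * i - 1)))) :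
    Tendsto (fun t : ℝ =>
        (∑ k ∈ Finset.Icc 2 n, d k *
          ∑ j ∈ (Finset.Nat.antidiagonalTuple (n - 1) k).filter
              (fun j => ∑ i : Fin (n - 1), ((i : ℕ) + 1) * j i = n),
            ((n.factorial : ℝ) / ∏ i : Fin (n - 1), ((j i).factorial : ℝ)) *
              ∏ i : Fin (n - 1),
                (P ((i : ℕ) + 1) t / (((i : ℕ) + 1).factorial : ℝ)) ^ (j i))
          * (Real.log t) ^ (2 * n - 2) / t ^ (n - 2))
      atTop
      (nhds ((n.factorial : ℝ) * (d 2 / 2) * (α * d 2 / 2) ^ (n - 2) * ((n : ℝ) - 1)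
        / c ^ (2 * n - 2))) := by
  have hQ : ∀ i : Fin (n - 1), Tendsto (fun t : ℝ =>
      P ((i : ℕ) + 1) t / (((i : ℕ) + 1).factorial : ℝ) * Real.log t ^ (2 * (i : ℕ) + 1)
        / t ^ (i : ℕ)) atTop (nhds ((α * d 2 / 2) ^ (i : ℕ) / c ^ (2 * (i : ℕ) + 1))) := by
    intro i
    have hf : (((i : ℕ) + 1).factorial : ℝ) ≠ 0 := by positivity
    have h := (hP_lim ((i : ℕ) + 1) (by omega) (by omega)).div_const
      (((i : ℕ) + 1).factorial : ℝ)
    rw [show 2 * ((i : ℕ) + 1) - 1 = 2 * (i : ℕ) + 1 by omega, Nat.add_sub_cancel] at h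
    convert h using 1
    · ext t
      ring
    · field_simp
  have hLt : Tendsto (fun t : ℝ => Real.log t / t) atTop (nhds 0) :=
    Real.isLittleO_log_id_atTop.tendsto_div_nhds_zero
  have hmain : Tendsto (fun t : ℝ => ∑ k ∈ Finset.Icc 2 n, d k *
      ∑ j ∈ (Finset.Nat.antidiagonalTuple (n - 1) k).filter
          (fun j => ∑ i : Fin (n - 1), ((i : ℕ) + 1) * j i = n),
        ((n.factorial : ℝ) / ∏ i : Fin (n - 1), ((j i).factorial : ℝ)) *
          ((∏ i : Fin (n - 1), (P ((i : ℕ) + 1) t / (((i : ℕ) + 1).factorial : ℝ)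
            * Real.log t ^ (2 * (i : ℕ) + 1) / t ^ (i : ℕ)) ^ j i)
              * (Real.log t / t) ^ (k - 2))) atTop
      (nhds (∑ k ∈ Finset.Icc 2 n, d k *
      ∑ j ∈ (Finset.Nat.antidiagonalTuple (n - 1) k).filter
          (fun j => ∑ i : Fin (n - 1), ((i : ℕ) + 1) * j i = n),
        ((n.factorial : ℝ) / ∏ i : Fin (n - 1), ((j i).factorial : ℝ)) *
          ((∏ i : Fin (n - 1), ((α * d 2 / 2) ^ (i : ℕ) / c ^ (2 * (i : ℕ) + 1)) ^ j i)
              * (0 : ℝ) ^ (k - 2)))) :=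
    tendsto_finsetSum _ fun k _ => (tendsto_finsetSum _ fun j _ =>
      ((tendsto_finsetProd _ fun i _ => (hQ i).pow (j i)).mul
        (hLt.pow (k - 2))).const_mul _).const_mul _
  have hlim : (∑ k ∈ Finset.Icc 2 n, d k *
      ∑ j ∈ (Finset.Nat.antidiagonalTuple (n - 1) k).filter
          (fun j => ∑ i : Fin (n - 1), ((i : ℕ) + 1) * j i = n),
        ((n.factorial : ℝ) / ∏ i : Fin (n - 1), ((j i).factorial : ℝ)) *
          ((∏ i : Fin (n - 1), ((α * d 2 / 2) ^ (i : ℕ) / c ^ (2 * (i : ℕ) + 1)) ^ j i)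
              * (0 : ℝ) ^ (k - 2))) =
      (n.factorial : ℝ) * (d 2 / 2) * (α * d 2 / 2) ^ (n - 2) * ((n : ℝ) - 1)
        / c ^ (2 * n - 2) := by
    rw [Finset.sum_eq_single_of_mem 2 (Finset.mem_Icc.2 ⟨le_rfl, hn⟩)]
    · have hsum := sum_inv_prod_factorial_antidiagonalTuple_two (n - 1)
      rw [Nat.sub_add_cancel (by omega : 1 ≤ n), Nat.cast_pred (by omega)] at hsum
      have hterm : ∀ j ∈ (Finset.Nat.antidiagonalTuple (n - 1) 2).filter
          (fun j => ∑ i : Fin (n - 1), ((i : ℕ) + 1) * j i = n),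
          ((n.factorial : ℝ) / ∏ i : Fin (n - 1), ((j i).factorial : ℝ)) *
            ((∏ i : Fin (n - 1), ((α * d 2 / 2) ^ (i : ℕ) / c ^ (2 * (i : ℕ) + 1)) ^ j i)
              * (0 : ℝ) ^ (2 - 2)) =
          (n.factorial : ℝ) * ((α * d 2 / 2) ^ (n - 2) / c ^ (2 * n - 2)) *
            (1 / ∏ i : Fin (n - 1), ((j i).factorial : ℝ)) := by
        intro j hj
        rw [Finset.mem_filter, Finset.Nat.mem_antidiagonalTuple] at hj
        rw [prod_pow_div_pow j hj.1 hj.2, Nat.sub_self, pow_zero]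
        ring
      rw [Finset.sum_congr rfl hterm, ← Finset.mul_sum, hsum]
      ring
    · intro k hk hk2
      have hk' := (Finset.mem_Icc.1 hk).1
      simp [zero_pow (by omega : k - 2 ≠ 0)]
  rw [← hlim]
  refine hmain.congr' ?_
  filter_upwards [eventually_gt_atTop (0 : ℝ)] with t ht
  rw [Finset.sum_mul, Finset.sum_div]
  refine Finset.sum_congr rfl fun k hk => ?_
  rw [mul_assoc, mul_div_assoc, Finset.sum_mul, Finset.sum_div]
  congr 1
  refine Finset.sum_congr rfl fun j hj => ?_
  rw [Finset.mem_filter, Finset.Nat.mem_antidiagonalTuple] at hj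
  rw [← prod_pow_mul_pow_div_pow (Finset.mem_Icc.1 hk).1 _ j hj.1 hj.2
    (Real.log t) ht.ne']
  ring
end
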